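/- Let A ∈ ℂ^{N×N} with a fixed singular value decomposition A = Σ_j λ_j u_j v_j*, and choose r, s, 1/ε ∈ {1,…,N} and p ∈ (0,1). Set t := max{4s, 512·r·⌈ln(231N/p)⌉/ε} and K := t·⌈log_t N⌉. Let B'_N be the extended bit testing matrix, let W ∈ {0,1}^{m'×N} be a (K, ⌊log_K N⌋)-coherent matrix with exactly K ones per column for which W̃ := (1/√(K(1+⌈log₂N⌉)))·(W ⊙ B'_N) has the Restricted Isometry Property of order (64·max{r·ln(231/(εp)), ln(48(N−r)/p)}, ε/8), let D ∈ ℝ^{N×N} be a random diagonal matrix with i.i.d. Rademacher (±1) entries on its diagonal, and set M := W̃·D ∈ ℝ^{m×N} with m = 2(1+⌈log₂N⌉)m'. Then: (i) with probability at least 1−p, M simultaneously is an ε-JL map of the column space of A_r := Σ_{j≤r} λ_j u_j v_j*, an ε-JL map of the column space of A_r*, and an ε-JL map of the set {u_j : r < j ≤ N} ∪ {v_j : r < j ≤ N}; and (ii) for every realization of D, there exists a map f : ℂ^m → ℂ^N (with 2s-sparse outputs) such that for all u ∈ ℂ^N and all n ∈ ℂ^m: ‖u − √(K(1+⌈log₂N⌉))·D·f(Mu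 + n)‖₂ ≤ ‖u − u_{2s}‖₂ + 6(1+√2)·( ‖u − u_s‖₁/√s + β_m(n)·‖n‖₂ ), where β_m(n) := ‖n‖_∞·√(sK(1+⌈log₂N⌉))/‖n‖₂. -/

import Mathlib

open scoped Matrix Classical

/-- A binary matrix `W` is `(K, α)`-coherent: it has `{0,1}` entries, every column contains at
least `K` ones, and distinct columns have inner product at most `α`. -/
def Coherent {m N : ℕ} (W : Matrix (Fin m) (Fin N) ℝ) (K : ℕ) (α : ℝ) : Prop :=
  (∀ i j, W i j = 0 ∨ W i j = 1) ∧
  (∀ j, (K : ℝ) ≤ ∑ i, W i j) ∧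
  (∀ j l, j ≠ l → ∑ i, W i j * W i l ≤ α)

/-- The bit testing matrix `B_N ∈ {0,1}^{(1+⌈log₂N⌉)×N}`: the `k`-th column (0-based) is a `1`
followed by the binary expansion of `k`. -/
def bitTest (N : ℕ) : Matrix (Fin (1 + Nat.clog 2 N)) (Fin N) ℝ :=
  fun i k => if (i : ℕ) = 0 then 1 else if Nat.testBit (k : ℕ) ((i : ℕ) - 1) then 1 else 0

/-- The extended bit testing matrix `B'_N ∈ {0,1}^{2(1+⌈log₂N⌉)×N}`, obtained by appending to
each column of `B_N` its binary complement. -/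
def bitTestExt (N : ℕ) : Matrix (Fin (2 * (1 + Nat.clog 2 N))) (Fin N) ℝ :=
  fun i k =>
    if h : (i : ℕ) < 1 + Nat.clog 2 N then bitTest N ⟨i, h⟩ k
    else 1 - bitTest N ⟨(i : ℕ) - (1 + Nat.clog 2 N), by have := i.isLt; omega⟩ k

/-- The Khatri–Rao (columnwise Kronecker) product: `(B ⊙ C)_{qm+r,k} = B_{r,k}·C_{q,k}`. -/
def khatriRao {m p N : ℕ} (B : Matrix (Fin m) (Fin N) ℝ) (C : Matrix (Fin p) (Fin N) ℝ) :
    Matrix (Fin (m * p)) (Fin N) ℝ :=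
  fun i k =>
    B ⟨(i : ℕ) % m, Nat.mod_lt _ (Nat.pos_of_ne_zero
        (by rintro rfl; exact absurd i.isLt (by simp)))⟩ k *
    C ⟨(i : ℕ) / m, Nat.div_lt_of_lt_mul i.isLt⟩ k

/-- The squared Euclidean (ℓ²) norm of a vector in `ℂ^n`. -/
noncomputable def nsq {n : ℕ} (x : Fin n → ℂ) : ℝ := ∑ i, ‖x i‖ ^ 2

/-- The Euclidean (ℓ²) norm of a vector in `ℂ^n`. -/
noncomputable def l2 {n : ℕ} (x : Fin n → ℂ) : ℝ := Real.sqrt (nsq x)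

/-- The ℓ^∞ norm of a vector in `ℂ^n`. -/
noncomputable def linf {n : ℕ} (x : Fin n → ℂ) : ℝ := ⨆ i, ‖x i‖

/-- The best `s`-sparse approximation error of `u` in the ℓ¹ norm. -/
noncomputable def bestErr1 {N : ℕ} (u : Fin N → ℂ) (s : ℕ) : ℝ :=
  sInf {t : ℝ | ∃ v : Fin N → ℂ, Set.ncard {i | v i ≠ 0} ≤ s ∧ t = ∑ i, ‖u i - v i‖}

/-- The best `s`-sparse approximation error of `u` in the ℓ² norm. -/
noncomputable def bestErr2 {N : ℕ} (u : Fin N → ℂ) (s : ℕ) : ℝ :=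
  sInf {t : ℝ | ∃ v : Fin N → ℂ, Set.ncard {i | v i ≠ 0} ≤ s ∧ t = l2 (u - v)}

/-- A real matrix `M` is an `ε`-JL map of the set `S ⊆ ℂ^N` (entries coerced into `ℂ`). -/
def IsJLMapR {m N : ℕ} (M : Matrix (Fin m) (Fin N) ℝ) (ε : ℝ) (S : Set (Fin N → ℂ)) : Prop :=
  ∀ x ∈ S, (1 - ε) * nsq x ≤ nsq ((M.map (fun a => (a : ℂ))).mulVec x) ∧
    nsq ((M.map (fun a => (a : ℂ))).mulVec x) ≤ (1 + ε) * nsq x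

/-- A real matrix `M` has the Restricted Isometry Property of order `(s, ε)`, with a real
sparsity level `s`. -/
def RIPr {m N : ℕ} (M : Matrix (Fin m) (Fin N) ℝ) (s : ℝ) (ε : ℝ) : Prop :=
  ∀ x : Fin N → ℂ, (Set.ncard {i | x i ≠ 0} : ℝ) ≤ s →
    (1 - ε) * nsq x ≤ nsq ((M.map (fun a => (a : ℂ))).mulVec x) ∧
    nsq ((M.map (fun a => (a : ℂ))).mulVec x) ≤ (1 + ε) * nsq x

/-- The random diagonal sign matrix determined by `δ : Fin N → Bool` (i.i.d. Rademacher). -/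
def diagSign {N : ℕ} (δ : Fin N → Bool) : Matrix (Fin N) (Fin N) ℝ :=
  Matrix.diagonal (fun i => if δ i then 1 else -1)

/-- The head `A_r = Σ_{j ≤ r} λ_j u_j v_j*` of a singular value decomposition. -/
noncomputable def headMat {N : ℕ} (lam : Fin N → ℝ) (u v : Fin N → Fin N → ℂ) (r : ℕ) :
    Matrix (Fin N) (Fin N) ℂ :=
  ∑ j : Fin N, if (j : ℕ) < r then
    lam j • Matrix.vecMulVec (u j) (fun k => (starRingEnd ℂ) (v j k)) else 0

/-- The real sign attached to a Boolean. -/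
def boolSign (b : Bool) : ℝ := if b then 1 else -1

lemma boolSign_sq (b : Bool) : boolSign b ^ 2 = 1 := by
  cases b <;> simp [boolSign]

lemma boolSign_mul_self (b : Bool) : boolSign b * boolSign b = 1 := by
  cases b <;> simp [boolSign]

lemma sum_bool_exp_boolSign_mul_le (c : ℝ) :
    ∑ b : Bool, Real.exp (boolSign b * c) ≤ 2 * Real.exp (c ^ 2 / 2) := by
  have h := Real.cosh_le_exp_half_sq c
  rw [Real.cosh_eq] at h
  simp only [Fintype.sum_bool, boolSign]
  norm_num
  linarith

/-- The moment generating function bound for Rademacher sums. -/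
lemma sum_exp_rademacher_le {n : ℕ} (c : Fin n → ℝ) :
    ∑ ξ : Fin n → Bool, Real.exp (∑ i, boolSign (ξ i) * c i) ≤
      2 ^ n * Real.exp ((∑ i, c i ^ 2) / 2) := by
  have h1 : ∑ ξ : Fin n → Bool, Real.exp (∑ i, boolSign (ξ i) * c i) =
      ∏ i, ∑ b : Bool, Real.exp (boolSign b * c i) := by
    rw [Finset.prod_univ_sum, Fintype.piFinset_univ]
    simp only [Real.exp_sum]
  have h2 : (2 : ℝ) ^ n * Real.exp ((∑ i, c i ^ 2) / 2) =
      ∏ i, (2 * Real.exp (c i ^ 2 / 2)) := by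
    rw [Finset.prod_mul_distrib, ← Real.exp_sum, Finset.sum_div]
    simp
  rw [h1, h2]
  exact Finset.prod_le_prod (fun i _ => Finset.sum_nonneg fun b _ => (Real.exp_pos _).le)
    fun i _ => sum_bool_exp_boolSign_mul_le (c i)

/-- The moment generating function bound for Rademacher quadratic forms: only an upper bound on
the quadratic form and nonnegativity of its diagonal are needed. -/
lemma sum_exp_quadratic_rademacher_le {β : ℝ} (hβ : β < 1) : ∀ {n : ℕ} (B : Fin n → Fin n → ℝ),
    (∀ i j, B i j = B j i) → (∀ i, 0 ≤ B i i) →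
    (∀ y : Fin n → ℝ, ∑ i, ∑ j, B i j * y i * y j ≤ β * ∑ i, y i ^ 2) →
    ∑ ξ : Fin n → Bool,
      Real.exp ((∑ i, ∑ j, B i j * boolSign (ξ i) * boolSign (ξ j)) / 2) ≤
      2 ^ n * Real.exp ((∑ i, B i i) / 2 + (∑ i, ∑ j, B i j ^ 2) / (4 * (1 - β))) := by
  intro n
  induction n with
  | zero => intro B _ _ _; simp
  | succ n ih =>
    intro B hsymm hdiag hop
    set b : Fin n → ℝ := fun i => B 0 i.succ with hb
    set B' : Fin n → Fin n → ℝ := fun i j => B i.succ j.succ + b i * b j with hB'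
    have quad : ∀ (a : ℝ) (y : Fin n → ℝ),
        ∑ i, ∑ j, B i j * (Fin.cons a y : Fin (n + 1) → ℝ) i * (Fin.cons a y : Fin (n + 1) → ℝ) j
        = B 0 0 * a ^ 2 + 2 * a * (∑ i, b i * y i) +
          ∑ i, ∑ j, B i.succ j.succ * y i * y j := by
      intro a y
      simp only [Fin.sum_univ_succ, Fin.cons_zero, Fin.cons_succ, Finset.sum_add_distrib]
      have : ∑ i : Fin n, B i.succ 0 * y i * a = a * ∑ i, b i * y i := by
        rw [Finset.mul_sum]
        exact Finset.sum_congr rfl fun i _ => by rw [hb, hsymm]; ring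
      have h2 : ∑ i : Fin n, B 0 i.succ * a * y i = a * ∑ i, b i * y i := by
        rw [Finset.mul_sum]
        exact Finset.sum_congr rfl fun i _ => by rw [hb]; ring
      rw [this, h2]; ring
    have rank1 : ∀ y : Fin n → ℝ, ∑ i, ∑ j, B' i j * y i * y j =
        ∑ i, ∑ j, B i.succ j.succ * y i * y j + (∑ i, b i * y i) ^ 2 := by
      intro y
      rw [sq, Finset.sum_mul_sum, ← Finset.sum_add_distrib]
      refine Finset.sum_congr rfl fun i _ => ?_
      rw [← Finset.sum_add_distrib]
      exact Finset.sum_congr rfl fun j _ => by rw [hB']; ring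
    have hop' : ∀ y : Fin n → ℝ, ∑ i, ∑ j, B' i j * y i * y j ≤ β * ∑ i, y i ^ 2 := by
      intro y
      have h := hop (Fin.cons (∑ i, b i * y i) y)
      rw [quad, Fin.sum_univ_succ] at h
      simp only [Fin.cons_zero, Fin.cons_succ] at h
      rw [rank1]
      nlinarith [hdiag 0, sq_nonneg (∑ i, b i * y i),
        mul_nonneg (hdiag 0) (sq_nonneg (∑ i, b i * y i))]
    have key := ih B' (fun i j => by simp only [hB']; rw [hsymm]; ring)
      (fun i => add_nonneg (hdiag _) (mul_self_nonneg _)) hop'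
    have step : ∑ ξ : Fin (n + 1) → Bool,
        Real.exp ((∑ i, ∑ j, B i j * boolSign (ξ i) * boolSign (ξ j)) / 2) ≤
        2 * Real.exp (B 0 0 / 2) * ∑ ξ : Fin n → Bool,
          Real.exp ((∑ i, ∑ j, B' i j * boolSign (ξ i) * boolSign (ξ j)) / 2) := by
      rw [← (Fin.consEquiv fun _ => Bool).sum_comp, Fintype.sum_prod_type, Finset.sum_comm,
        Finset.mul_sum]
      refine Finset.sum_le_sum fun ξ _ => ?_
      have e1 : ∀ a : Bool,
          Real.exp ((∑ i, ∑ j, B i j * boolSign ((Fin.consEquiv fun _ => Bool) (a, ξ) i) *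
            boolSign ((Fin.consEquiv fun _ => Bool) (a, ξ) j)) / 2) =
          Real.exp (boolSign a * ∑ i, b i * boolSign (ξ i)) *
            Real.exp (B 0 0 / 2 +
              (∑ i, ∑ j, B i.succ j.succ * boolSign (ξ i) * boolSign (ξ j)) / 2) := by
        intro a
        have e2 : ∀ i, boolSign ((Fin.consEquiv fun _ => Bool) (a, ξ) i) =
            (Fin.cons (boolSign a) (fun i => boolSign (ξ i)) : Fin (n + 1) → ℝ) i := by
          intro i
          refine Fin.cases ?_ (fun i => ?_) i <;> simp [Fin.consEquiv]
        simp only [e2]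
        rw [quad, boolSign_sq, ← Real.exp_add]
        congr 1; ring
      rw [Finset.sum_congr rfl fun a _ => e1 a, ← Finset.sum_mul, rank1]
      calc _ ≤ _ := mul_le_mul_of_nonneg_right (sum_bool_exp_boolSign_mul_le _)
            (Real.exp_pos _).le
        _ = _ := by
          rw [mul_assoc, mul_assoc, ← Real.exp_add, ← Real.exp_add]
          congr 2; ring
    refine step.trans ?_
    calc _ ≤ 2 * Real.exp (B 0 0 / 2) * (2 ^ n * Real.exp ((∑ i, B' i i) / 2 +
          (∑ i, ∑ j, B' i j ^ 2) / (4 * (1 - β)))) := by gcongr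
      _ = 2 ^ (n + 1) * Real.exp (B 0 0 / 2 + ((∑ i, B' i i) / 2 +
          (∑ i, ∑ j, B' i j ^ 2) / (4 * (1 - β)))) := by
        rw [Real.exp_add (B 0 0 / 2)]; ring
      _ ≤ _ := by
        refine mul_le_mul_of_nonneg_left (Real.exp_le_exp.2 ?_) (by positivity)
        have hβ' : 0 < 1 - β := by linarith
        set β2 := ∑ i, b i ^ 2
        have htr : ∑ i, B' i i = ∑ i : Fin n, B i.succ i.succ + β2 := by
          simp only [hB', β2, ← Finset.sum_add_distrib, sq]
        have hF' : ∑ i, ∑ j, B' i j ^ 2 = ∑ i : Fin n, ∑ j : Fin n, B i.succ j.succ ^ 2 +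
            2 * ∑ i, ∑ j, B' i j * b i * b j - β2 ^ 2 := by
          rw [rank1]
          have : β2 ^ 2 = (∑ i, b i * b i) ^ 2 := by simp only [β2, sq]
          rw [this, sq, Finset.sum_mul_sum]
          simp only [mul_add, Finset.mul_sum, ← Finset.sum_add_distrib,
            ← Finset.sum_sub_distrib]
          refine Finset.sum_congr rfl fun i _ => Finset.sum_congr rfl fun j _ => ?_
          simp only [hB']; ring
        have hF : ∑ i, ∑ j, B i j ^ 2 = B 0 0 ^ 2 + 2 * β2 +
            ∑ i : Fin n, ∑ j : Fin n, B i.succ j.succ ^ 2 := by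
          simp only [Fin.sum_univ_succ, Finset.sum_add_distrib]
          have : ∑ i : Fin n, B i.succ 0 ^ 2 = β2 :=
            Finset.sum_congr rfl fun i _ => by rw [hsymm]
          rw [this]; simp only [β2, hb]; ring
        have hb2 := hop' b
        rw [htr, hF', hF, Fin.sum_univ_succ]
        have : (∑ i : Fin n, ∑ j : Fin n, B i.succ j.succ ^ 2 +
            2 * ∑ i, ∑ j, B' i j * b i * b j - β2 ^ 2) / (4 * (1 - β)) ≤
            (B 0 0 ^ 2 + 2 * β2 + ∑ i : Fin n, ∑ j : Fin n, B i.succ j.succ ^ 2)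
              / (4 * (1 - β)) - β2 / 2 := by
          rw [le_sub_iff_add_le, div_add' _ _ _ (by positivity)]
          refine div_le_div_of_nonneg_right ?_ (by positivity)
          nlinarith [sq_nonneg β2, sq_nonneg (B 0 0)]
        linarith

/-- The restriction of a vector to the block of coordinates labelled `J`. -/
noncomputable def blockPart {N : ℕ} (blk : Fin N → ℕ) (J : ℕ) (w : Fin N → ℝ) : Fin N → ℝ :=
  fun i => if blk i = J then w i else 0

/-- The sum over all blocks of the Euclidean norms of the restrictions of a vector. -/
noncomputable def blockNorm {N : ℕ} (blk : Fin N → ℕ) (w : Fin N → ℝ) : ℝ :=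
  ∑ J ∈ Finset.range N, √(∑ i, blockPart blk J w i ^ 2)

lemma sum_blockPart_sq {N : ℕ} {blk : Fin N → ℕ} (hblk : ∀ i, blk i < N) (w : Fin N → ℝ) :
    ∑ J ∈ Finset.range N, ∑ i, blockPart blk J w i ^ 2 = ∑ i, w i ^ 2 := by
  rw [Finset.sum_comm]
  refine Finset.sum_congr rfl fun i _ => ?_
  rw [Finset.sum_eq_single (blk i)]
  · simp [blockPart]
  · intro J _ hJ
    simp [blockPart, hJ.symm]
  · intro h
    exact absurd (Finset.mem_range.2 (hblk i)) h

lemma sum_blockPart {N : ℕ} {blk : Fin N → ℕ} (hblk : ∀ i, blk i < N) (w : Fin N → ℝ) :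
    ∑ J ∈ Finset.range N, blockPart blk J w = w := by
  ext i
  rw [Finset.sum_apply, Finset.sum_eq_single (blk i)]
  · simp [blockPart]
  · intro J _ hJ
    simp [blockPart, hJ.symm]
  · intro h
    exact absurd (Finset.mem_range.2 (hblk i)) h

/-- A quadratic form that is small on `2s`-sparse vectors has a small polar form on pairs of
vectors, each supported on a set of size at most `s`. -/
lemma abs_bilin_le_of_support {N s : ℕ} {δ : ℝ} (hδ : 0 ≤ δ)
    (G : LinearMap.BilinForm ℝ (Fin N → ℝ)) (hsymm : ∀ u v, G u v = G v u)
    (hG : ∀ w : Fin N → ℝ, Set.ncard {i | w i ≠ 0} ≤ 2 * s → |G w w| ≤ δ * ∑ i, w i ^ 2)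
    {S T : Finset (Fin N)} (hS : S.card ≤ s) (hT : T.card ≤ s) {u v : Fin N → ℝ}
    (hu : ∀ i ∉ S, u i = 0) (hv : ∀ i ∉ T, v i = 0) :
    |G u v| ≤ δ * √(∑ i, u i ^ 2) * √(∑ i, v i ^ 2) := by
  have sparse : ∀ a b : ℝ, Set.ncard {i | (a • u + b • v) i ≠ 0} ≤ 2 * s := by
    intro a b
    have : {i | (a • u + b • v) i ≠ 0} ⊆ ((S ∪ T : Finset (Fin N)) : Set (Fin N)) := by
      intro i hi
      by_contra h
      rw [Finset.mem_coe, Finset.mem_union, not_or] at h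
      exact hi (by simp [hu i h.1, hv i h.2])
    calc _ ≤ Set.ncard ((S ∪ T : Finset (Fin N)) : Set (Fin N)) :=
          Set.ncard_le_ncard this (Finset.finite_toSet _)
      _ = (S ∪ T).card := Set.ncard_coe_finset _
      _ ≤ S.card + T.card := Finset.card_union_le _ _
      _ ≤ 2 * s := by omega
  have expand : ∀ a b : ℝ, ∑ i, (a • u + b • v) i ^ 2 =
      a ^ 2 * ∑ i, u i ^ 2 + 2 * a * b * ∑ i, u i * v i + b ^ 2 * ∑ i, v i ^ 2 := by
    intro a b
    simp only [Finset.mul_sum, ← Finset.sum_add_distrib]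
    exact Finset.sum_congr rfl fun i _ => by
      simp only [Pi.add_apply, Pi.smul_apply, smul_eq_mul]; ring
  have expandG : ∀ a b : ℝ, G (a • u + b • v) (a • u + b • v) =
      a ^ 2 * G u u + 2 * a * b * G u v + b ^ 2 * G v v := by
    intro a b
    simp only [map_add, map_smul, LinearMap.add_apply, LinearMap.smul_apply, smul_eq_mul]
    rw [hsymm v u]; ring
  have quad : ∀ a : ℝ, 0 ≤ (δ * ∑ i, u i ^ 2) * (a * a) + (-2 * G u v) * a +
      δ * ∑ i, v i ^ 2 := by
    intro a
    have h1 := hG _ (sparse a 1)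
    have h2 := hG _ (sparse a (-1))
    rw [expand, expandG] at h1 h2
    rw [abs_le] at h1 h2
    nlinarith [h1.2, h2.1]
  have hd := discrim_le_zero quad
  rw [discrim] at hd
  have hU : 0 ≤ ∑ i, u i ^ 2 := Finset.sum_nonneg fun i _ => sq_nonneg _
  have hV : 0 ≤ ∑ i, v i ^ 2 := Finset.sum_nonneg fun i _ => sq_nonneg _
  refine abs_le_of_sq_le_sq ?_ (by positivity)
  rw [mul_pow, mul_pow, Real.sq_sqrt hU, Real.sq_sqrt hV]
  nlinarith

lemma abs_bilin_le_blockNorm {N s : ℕ} {δ : ℝ} (hδ : 0 ≤ δ)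
    (G : LinearMap.BilinForm ℝ (Fin N → ℝ)) (hsymm : ∀ u v, G u v = G v u)
    (hG : ∀ w : Fin N → ℝ, Set.ncard {i | w i ≠ 0} ≤ 2 * s → |G w w| ≤ δ * ∑ i, w i ^ 2)
    {blk : Fin N → ℕ} (hblk : ∀ i, blk i < N)
    (hcard : ∀ J, (Finset.univ.filter fun i => blk i = J).card ≤ s) (u v : Fin N → ℝ) :
    |G u v| ≤ δ * blockNorm blk u * blockNorm blk v := by
  conv_lhs => rw [← sum_blockPart hblk u, ← sum_blockPart hblk v]
  rw [LinearMap.map_sum₂]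
  simp only [map_sum]
  refine (Finset.abs_sum_le_sum_abs _ _).trans ?_
  rw [blockNorm, blockNorm, mul_assoc, Finset.sum_mul_sum, Finset.mul_sum]
  refine Finset.sum_le_sum fun J _ => (Finset.abs_sum_le_sum_abs _ _).trans ?_
  rw [Finset.mul_sum]
  refine Finset.sum_le_sum fun L _ => ?_
  rw [← mul_assoc]
  refine abs_bilin_le_of_support hδ G hsymm hG (hcard J) (hcard L) ?_ ?_
  · intro i hi
    simp only [Finset.mem_filter, Finset.mem_univ, true_and] at hi
    simp [blockPart, hi]
  · intro i hi
    simp only [Finset.mem_filter, Finset.mem_univ, true_and] at hi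
    simp [blockPart, hi]

/-- The coordinates of a vector can be grouped into blocks of size at most `s` in decreasing order
of magnitude: each entry outside the first block is bounded by the mean square of the preceding
block. -/
lemma exists_decreasing_blocks {N s : ℕ} (hs : 0 < s) (x : Fin N → ℝ) :
    ∃ blk : Fin N → ℕ, (∀ i, blk i < N) ∧
      (∀ J, (Finset.univ.filter fun i => blk i = J).card ≤ s) ∧
      ∀ i, ∀ J, blk i = J + 1 → s * x i ^ 2 ≤ ∑ k, blockPart blk J x k ^ 2 := by
  set σ := Tuple.sort fun i => -(x i ^ 2) with hσ
  have hmono : ∀ a b : Fin N, a ≤ b → x (σ b) ^ 2 ≤ x (σ a) ^ 2 := fun a b hab => by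
    have := Tuple.monotone_sort (fun i => -(x i ^ 2)) hab
    simp only [Function.comp_apply, ← hσ] at this
    linarith
  refine ⟨fun i => (σ.symm i : ℕ) / s, fun i => (Nat.div_le_self _ _).trans_lt (σ.symm i).isLt,
    fun J => ?_, fun i J hJ => ?_⟩
  · calc _ = ((Finset.univ.filter fun i : Fin N => (σ.symm i : ℕ) / s = J).image
          fun i => (σ.symm i : ℕ)).card := by
          rw [Finset.card_image_of_injective]
          exact Fin.val_injective.comp σ.symm.injective
      _ ≤ (Finset.Ico (J * s) (J * s + s)).card := by
        refine Finset.card_le_card fun q hq => ?_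
        simp only [Finset.mem_image, Finset.mem_filter, Finset.mem_univ, true_and] at hq
        obtain ⟨i, rfl, rfl⟩ := hq
        rw [Finset.mem_Ico]
        have h1 := Nat.div_add_mod (σ.symm i : ℕ) s
        have h2 := Nat.mod_lt (σ.symm i : ℕ) hs
        rw [mul_comm] at h1
        omega
      _ = s := by simp
  · have h1 := Nat.div_add_mod (σ.symm i : ℕ) s
    rw [show (σ.symm i : ℕ) / s = J + 1 from hJ] at h1
    have hlt : J * s + s ≤ (σ.symm i : ℕ) := by
      rw [show s * (J + 1) = J * s + s by ring] at h1
      omega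
    have hN := (σ.symm i).isLt
    let g : Fin s → Fin N := fun q => σ ⟨J * s + q, by omega⟩
    have hg : Function.Injective g := by
      intro a b hab
      have := σ.injective hab
      simp only [Fin.mk.injEq] at this
      ext; omega
    calc (s : ℝ) * x i ^ 2 = ∑ _q : Fin s, x i ^ 2 := by simp
      _ ≤ ∑ q : Fin s, x (g q) ^ 2 := by
        refine Finset.sum_le_sum fun q _ => ?_
        have := hmono ⟨J * s + q, by omega⟩ (σ.symm i) (by rw [Fin.le_def]; simp only; omega)
        simpa using this
      _ = ∑ k ∈ Finset.univ.map ⟨g, hg⟩, x k ^ 2 := by simp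
      _ = ∑ k ∈ Finset.univ.map ⟨g, hg⟩, blockPart (fun i => (σ.symm i : ℕ) / s) J x k ^ 2 := by
        refine Finset.sum_congr rfl fun k hk => ?_
        simp only [Finset.mem_map, Finset.mem_univ, true_and, Function.Embedding.coeFn_mk] at hk
        obtain ⟨q, rfl⟩ := hk
        have : (J * s + q) / s = J := by
          rw [mul_comm, Nat.mul_add_div hs, Nat.div_eq_of_lt q.isLt, add_zero]
        simp [blockPart, g, this]
      _ ≤ _ := Finset.sum_le_univ_sum_of_nonneg fun k => sq_nonneg _

/-- The block norm of the entrywise product `x ∘ y`, with the first block removed, for blocks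
which are decreasing for `x`. -/
lemma blockNorm_tail_mul_le {N s : ℕ} (hs : 0 < s) {x : Fin N → ℝ} {blk : Fin N → ℕ}
    (hblk : ∀ i, blk i < N)
    (hdec : ∀ i, ∀ J, blk i = J + 1 → s * x i ^ 2 ≤ ∑ k, blockPart blk J x k ^ 2)
    (hx : ∑ i, x i ^ 2 = 1) (y : Fin N → ℝ) :
    blockNorm blk (fun i => if blk i = 0 then 0 else x i * y i) ≤ √((∑ i, y i ^ 2) / s) := by
  have hs' : (0 : ℝ) < s := by exact_mod_cast hs
  cases N with
  | zero => simp [blockNorm]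
  | succ n =>
  set Y : Fin (n + 1) → ℝ := fun i => if blk i = 0 then 0 else x i * y i with hY
  have h0 : √(∑ i, blockPart blk 0 Y i ^ 2) = 0 := by
    rw [Finset.sum_eq_zero, Real.sqrt_zero]
    intro i _
    by_cases h : blk i = 0 <;> simp [blockPart, hY, h]
  have hJ : ∀ J, √(∑ i, blockPart blk (J + 1) Y i ^ 2) ≤
      √(∑ i, blockPart blk J x i ^ 2) * √((∑ i, blockPart blk (J + 1) y i ^ 2) / s) := by
    intro J
    rw [← Real.sqrt_mul (Finset.sum_nonneg fun i _ => sq_nonneg _)]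
    refine Real.sqrt_le_sqrt ?_
    rw [mul_div_assoc', le_div_iff₀ hs', Finset.sum_mul, Finset.mul_sum]
    refine Finset.sum_le_sum fun i _ => ?_
    by_cases h : blk i = J + 1
    · have := hdec i J h
      simp only [blockPart, hY, h, if_true, Nat.succ_ne_zero, if_false] at this ⊢
      nlinarith [mul_le_mul_of_nonneg_right this (sq_nonneg (y i))]
    · simp [blockPart, h]
  rw [blockNorm, Finset.sum_range_succ', h0, add_zero]
  calc _ ≤ ∑ J ∈ Finset.range n, √(∑ i, blockPart blk J x i ^ 2) *
        √((∑ i, blockPart blk (J + 1) y i ^ 2) / s) := Finset.sum_le_sum fun J _ => hJ J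
    _ ≤ √(∑ J ∈ Finset.range n, ∑ i, blockPart blk J x i ^ 2) *
        √(∑ J ∈ Finset.range n, (∑ i, blockPart blk (J + 1) y i ^ 2) / s) :=
      Real.sum_sqrt_mul_sqrt_le _ (fun J => Finset.sum_nonneg fun i _ => sq_nonneg _)
        (fun J => div_nonneg (Finset.sum_nonneg fun i _ => sq_nonneg _) hs'.le)
    _ ≤ 1 * √((∑ i, y i ^ 2) / s) := by
      gcongr
      · refine Real.sqrt_le_one.2 ?_
        rw [← hx, ← sum_blockPart_sq hblk x, Finset.sum_range_succ]
        exact le_add_of_nonneg_right (Finset.sum_nonneg fun i _ => sq_nonneg _)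
      · rw [← Finset.sum_div]
        gcongr
        rw [← sum_blockPart_sq hblk y, Finset.sum_range_succ']
        exact le_add_of_nonneg_right (Finset.sum_nonneg fun i _ => sq_nonneg _)
    _ = _ := one_mul _

lemma bilin_eq_sum {N : ℕ} (G : LinearMap.BilinForm ℝ (Fin N → ℝ)) (u v : Fin N → ℝ) :
    G u v = ∑ i, ∑ j, u i * v j * G (Pi.single i 1) (Pi.single j 1) := by
  conv_lhs => rw [pi_eq_sum_univ' u, pi_eq_sum_univ' v]
  rw [LinearMap.map_sum₂]
  refine Finset.sum_congr rfl fun i _ => ?_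
  rw [map_sum]
  refine Finset.sum_congr rfl fun j _ => ?_
  simp only [map_smul, LinearMap.smul_apply, smul_eq_mul]
  ring

lemma bilin_left_eq_sum {N : ℕ} (G : LinearMap.BilinForm ℝ (Fin N → ℝ)) (u v : Fin N → ℝ) :
    G u v = ∑ i, u i * G (Pi.single i 1) v := by
  conv_lhs => rw [pi_eq_sum_univ' u]
  rw [LinearMap.map_sum₂]
  refine Finset.sum_congr rfl fun i _ => ?_
  simp only [map_smul, LinearMap.smul_apply, smul_eq_mul]

lemma blockNorm_le_of_support {N : ℕ} {blk : Fin N → ℕ} {J : ℕ} {w : Fin N → ℝ}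
    (hw : ∀ i, blk i ≠ J → w i = 0) : blockNorm blk w ≤ √(∑ i, w i ^ 2) := by
  have h : ∀ L, L ≠ J → √(∑ i, blockPart blk L w i ^ 2) = 0 := by
    intro L hL
    rw [Finset.sum_eq_zero, Real.sqrt_zero]
    intro i _
    by_cases h : blk i = L
    · simp [blockPart, h, hw i (h ▸ hL)]
    · simp [blockPart, h]
  rw [blockNorm]
  by_cases hJ : J ∈ Finset.range N
  · rw [Finset.sum_eq_single J (fun L _ hL => h L hL) fun h' => absurd hJ h']
    refine Real.sqrt_le_sqrt (Finset.sum_le_sum fun i _ => ?_)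
    by_cases h : blk i = J
    · simp [blockPart, h]
    · simp [blockPart, h, sq_nonneg]
  · rw [Finset.sum_eq_zero fun L hL => h L (ne_of_mem_of_not_mem hL hJ)]
    exact Real.sqrt_nonneg _

/-- Averaging over an independent copy of the coordinates outside a given set. -/
lemma sum_sum_mix {N : ℕ} (P : Fin N → Prop) [DecidablePred P] (F : (Fin N → Bool) → ℝ) :
    ∑ ξ : Fin N → Bool, ∑ η : Fin N → Bool, F (fun i => if P i then ξ i else η i) =
      2 ^ N * ∑ ξ, F ξ := by
  have hinv : Function.Involutive fun q : (Fin N → Bool) × (Fin N → Bool) =>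
      ((fun i => if P i then q.1 i else q.2 i : Fin N → Bool),
        (fun i => if P i then q.2 i else q.1 i : Fin N → Bool)) := by
    rintro ⟨ξ, η⟩
    ext i <;> by_cases h : P i <;> simp [h]
  rw [← Fintype.sum_prod_type' fun ξ η : Fin N → Bool => F (fun i => if P i then ξ i else η i)]
  have := Equiv.sum_comp (hinv.toPerm _) fun q : (Fin N → Bool) × (Fin N → Bool) => F q.1
  simp only [Function.Involutive.coe_toPerm] at this
  rw [this, Fintype.sum_prod_type]
  simp [Finset.mul_sum]

/-- A quadratic form which is small on sparse vectors has small entries against vectors of block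
norm at most one. -/
lemma sum_sq_tail_entries_le {N s : ℕ} {δ : ℝ} (hs : 0 < s) (hδ : 0 ≤ δ)
    (G : LinearMap.BilinForm ℝ (Fin N → ℝ)) {x : Fin N → ℝ} {blk : Fin N → ℕ}
    (hbil : ∀ u v, |G u v| ≤ δ * blockNorm blk u * blockNorm blk v)
    (htail : ∀ y : Fin N → ℝ,
      blockNorm blk (fun i => if blk i = 0 then 0 else x i * y i) ≤ √((∑ i, y i ^ 2) / s))
    {w : Fin N → ℝ} (hw : blockNorm blk w ≤ 1) :
    ∑ i, (if blk i = 0 then 0 else x i * G (Pi.single i 1) w) ^ 2 ≤ δ ^ 2 / s := by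
  have hs' : (0 : ℝ) < s := by exact_mod_cast hs
  set z : Fin N → ℝ := fun i => if blk i = 0 then 0 else x i * G (Pi.single i 1) w with hz
  have h1 : ∑ i, z i ^ 2 = G (fun i => if blk i = 0 then 0 else x i * z i) w := by
    rw [bilin_left_eq_sum]
    refine Finset.sum_congr rfl fun i _ => ?_
    by_cases h : blk i = 0
    · simp [hz, h]
    · simp only [hz, h, if_false]; ring
  set Z := ∑ i, z i ^ 2
  have hZ : 0 ≤ Z := Finset.sum_nonneg fun i _ => sq_nonneg _
  have hn : ∀ u : Fin N → ℝ, 0 ≤ blockNorm blk u := fun u =>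
    Finset.sum_nonneg fun J _ => Real.sqrt_nonneg _
  have h2 : Z ≤ δ * √(Z / s) := by
    calc Z ≤ |G (fun i => if blk i = 0 then 0 else x i * z i) w| := h1 ▸ le_abs_self _
      _ ≤ δ * blockNorm blk (fun i => if blk i = 0 then 0 else x i * z i) * blockNorm blk w :=
        hbil _ _
      _ ≤ δ * √(Z / s) * 1 := by
        gcongr
        exacts [hn _, htail z]
      _ = _ := mul_one _
  rcases hZ.eq_or_lt with h0 | hpos
  · change Z ≤ _
    rw [← h0]; positivity
  · have h3 : Z ^ 2 ≤ δ ^ 2 * (Z / s) := by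
      calc Z ^ 2 ≤ (δ * √(Z / s)) ^ 2 := by gcongr
        _ = _ := by rw [mul_pow, Real.sq_sqrt (by positivity)]
    change Z ≤ _
    rw [le_div_iff₀ hs']
    rw [mul_div_assoc', le_div_iff₀ hs'] at h3
    nlinarith

/-- The Krahmer–Ward concentration inequality for normalized vectors: a quadratic form that is
small on sparse vectors is small on randomly signed fixed vectors. -/
lemma card_large_quadratic_rademacher_le_of_unit {N s : ℕ} {δ : ℝ} (hs : 0 < s) (hδ : 0 < δ)
    (G : LinearMap.BilinForm ℝ (Fin N → ℝ)) (hsymm : ∀ u v, G u v = G v u)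
    (hG : ∀ w : Fin N → ℝ, Set.ncard {i | w i ≠ 0} ≤ 2 * s → |G w w| ≤ δ * ∑ i, w i ^ 2)
    (x : Fin N → ℝ) (hx : ∑ i, x i ^ 2 = 1) :
    ((Finset.univ.filter fun ξ : Fin N → Bool =>
      ¬ |G (fun i => boolSign (ξ i) * x i) (fun i => boolSign (ξ i) * x i)| ≤ 4 * δ).card : ℝ) ≤
      2 ^ N * (4 * Real.exp (-(5 / 32 * s))) := by
  have hs' : (0 : ℝ) < s := by exact_mod_cast hs
  obtain ⟨blk, hblk, hcard, hdec⟩ := exists_decreasing_blocks hs x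
  have hbil := abs_bilin_le_blockNorm hδ.le G hsymm hG hblk hcard
  have htail := blockNorm_tail_mul_le hs hblk hdec hx
  have hn : ∀ u : Fin N → ℝ, 0 ≤ blockNorm blk u := fun u =>
    Finset.sum_nonneg fun J _ => Real.sqrt_nonneg _
  set γ : Fin N → Fin N → ℝ := fun i j => G (Pi.single i 1) (Pi.single j 1) with hγ
  set tl : (Fin N → ℝ) → Fin N → ℝ := fun y i => if blk i = 0 then 0 else x i * y i with htl
  set hd : (Fin N → ℝ) → Fin N → ℝ := fun y i => if blk i = 0 then x i * y i else 0 with hhd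
  set sg : (Fin N → Bool) → Fin N → ℝ := fun ξ i => boolSign (ξ i) with hsg
  set C : Fin N → Fin N → ℝ := fun i j =>
    if blk i = 0 ∨ blk j = 0 ∨ i = j then 0 else x i * x j * γ i j with hC
  have hsingle : ∀ j, blockNorm blk (Pi.single j 1) ≤ 1 := fun j => by
    refine (blockNorm_le_of_support (J := blk j) fun i hi => ?_).trans ?_
    · rw [Pi.single_eq_of_ne]; rintro rfl; exact hi rfl
    · simp [Pi.single_apply]
  have hdiag : ∀ i, |γ i i| ≤ δ := fun i => by
    calc |γ i i| ≤ δ * blockNorm blk (Pi.single i 1) * blockNorm blk (Pi.single i 1) := hbil _ _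
      _ ≤ δ * 1 * 1 := by gcongr; exacts [hn _, hsingle i, hsingle i]
      _ = δ := by ring
  have hsmall : ∀ i, blk i ≠ 0 → x i ^ 2 ≤ 1 / s := fun i hi => by
    obtain ⟨J, hJ⟩ := Nat.exists_eq_succ_of_ne_zero hi
    rw [le_div_iff₀ hs', mul_comm, ← hx]
    refine (hdec i J hJ).trans (Finset.sum_le_sum fun k _ => ?_)
    by_cases h : blk k = J <;> simp [blockPart, h, sq_nonneg]
  have hCquad : ∀ y : Fin N → ℝ, ∑ i, ∑ j, C i j * y i * y j =
      G (tl y) (tl y) - ∑ i, tl y i ^ 2 * γ i i := by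
    intro y
    rw [bilin_eq_sum, ← Finset.sum_sub_distrib]
    refine Finset.sum_congr rfl fun i _ => ?_
    rw [eq_sub_iff_add_eq, ← Finset.sum_erase_add _ _ (Finset.mem_univ i),
      ← Finset.sum_erase_add _ (fun j => tl y i * tl y j * G (Pi.single i 1) (Pi.single j 1))
        (Finset.mem_univ i)]
    have : ∑ j ∈ Finset.univ.erase i, C i j * y i * y j = ∑ j ∈ Finset.univ.erase i,
        tl y i * tl y j * G (Pi.single i 1) (Pi.single j 1) := by
      refine Finset.sum_congr rfl fun j hj => ?_
      have hij : i ≠ j := (Finset.ne_of_mem_erase hj).symm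
      by_cases h1 : blk i = 0
      · simp [hC, htl, h1]
      by_cases h2 : blk j = 0
      · simp [hC, htl, h2]
      simp only [hC, htl, h1, h2, hij, or_self, if_false, hγ]; ring
    rw [this]
    simp only [hC, hγ]
    simp only [or_true, if_true]
    ring
  have hdiagsum : ∀ y : Fin N → ℝ, |∑ i, tl y i ^ 2 * γ i i| ≤ δ * ∑ i, tl y i ^ 2 := by
    intro y
    refine (Finset.abs_sum_le_sum_abs _ _).trans ?_
    rw [Finset.mul_sum]
    refine Finset.sum_le_sum fun i _ => ?_
    rw [abs_mul, abs_of_nonneg (sq_nonneg _), mul_comm]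
    exact mul_le_mul_of_nonneg_right (hdiag i) (sq_nonneg _)
  have htlsq : ∀ y : Fin N → ℝ, ∑ i, tl y i ^ 2 ≤ (∑ i, y i ^ 2) / s := by
    intro y
    rw [Finset.sum_div]
    refine Finset.sum_le_sum fun i _ => ?_
    by_cases h : blk i = 0
    · simp only [htl, h, if_true]; rw [zero_pow two_ne_zero]; positivity
    · simp only [htl, h, if_false, mul_pow]
      calc _ ≤ 1 / s * y i ^ 2 := mul_le_mul_of_nonneg_right (hsmall i h) (sq_nonneg _)
        _ = _ := by ring
  have hop : ∀ y : Fin N → ℝ, |∑ i, ∑ j, C i j * y i * y j| ≤ 2 * δ / s * ∑ i, y i ^ 2 := by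
    intro y
    have h1 : |G (tl y) (tl y)| ≤ δ * ((∑ i, y i ^ 2) / s) := by
      calc _ ≤ δ * blockNorm blk (tl y) * blockNorm blk (tl y) := hbil _ _
        _ ≤ δ * √((∑ i, y i ^ 2) / s) * √((∑ i, y i ^ 2) / s) := by
          gcongr; exacts [hn _, htail y, htail y]
        _ = _ := by rw [mul_assoc, Real.mul_self_sqrt
          (div_nonneg (Finset.sum_nonneg fun i _ => sq_nonneg _) hs'.le)]
    have h2 := (hdiagsum y).trans (mul_le_mul_of_nonneg_left (htlsq y) hδ.le)
    rw [hCquad]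
    calc _ ≤ _ := abs_sub _ _
      _ ≤ _ := add_le_add h1 h2
      _ = _ := by ring
  have hentries : ∀ w, blockNorm blk w ≤ 1 →
      ∑ i, (if blk i = 0 then 0 else x i * G (Pi.single i 1) w) ^ 2 ≤ δ ^ 2 / s :=
    fun w hw => sum_sq_tail_entries_le hs hδ.le G hbil htail hw
  have hF : ∑ i, ∑ j, C i j ^ 2 ≤ δ ^ 2 / s := by
    rw [Finset.sum_comm]
    calc _ ≤ ∑ j, x j ^ 2 * (δ ^ 2 / s) := by
          refine Finset.sum_le_sum fun j _ => ?_
          refine le_trans ?_ (mul_le_mul_of_nonneg_left (hentries _ (hsingle j)) (sq_nonneg _))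
          rw [Finset.mul_sum]
          refine Finset.sum_le_sum fun i _ => ?_
          by_cases h : blk i = 0 ∨ blk j = 0 ∨ i = j
          · simp only [hC]
            rw [if_pos h, zero_pow two_ne_zero]
            exact mul_nonneg (sq_nonneg _) (sq_nonneg _)
          · have h' : blk i ≠ 0 := fun h' => h (Or.inl h')
            simp only [hC, hγ]
            rw [if_neg h, if_neg h']
            exact le_of_eq (by ring)
      _ = _ := by rw [← Finset.sum_mul, hx, one_mul]
  have hsgsq : ∀ ξ, ∑ i, hd (sg ξ) i ^ 2 + ∑ i, tl (sg ξ) i ^ 2 = 1 := by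
    intro ξ
    rw [← hx, ← Finset.sum_add_distrib]
    refine Finset.sum_congr rfl fun i _ => ?_
    by_cases h : blk i = 0 <;> simp [hd, tl, h, mul_pow, hsg, boolSign_sq]
  have hhdnorm : ∀ ξ, blockNorm blk (hd (sg ξ)) ≤ √(∑ i, hd (sg ξ) i ^ 2) := fun ξ =>
    blockNorm_le_of_support (J := 0) fun i hi => by simp [hd, hi]
  have hhdle : ∀ ξ, ∑ i, hd (sg ξ) i ^ 2 ≤ 1 := fun ξ => by
    rw [← hsgsq ξ]
    exact le_add_of_nonneg_right (Finset.sum_nonneg fun i _ => sq_nonneg _)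
  set Q : (Fin N → Bool) → ℝ := fun ξ => ∑ i, ∑ j, C i j * sg ξ i * sg ξ j with hQ
  set X : (Fin N → Bool) → ℝ := fun ξ => 2 * G (tl (sg ξ)) (hd (sg ξ)) with hX
  have hdecomp : ∀ ξ, |G (fun i => boolSign (ξ i) * x i) (fun i => boolSign (ξ i) * x i)| ≤
      δ + |X ξ| + |Q ξ| := by
    intro ξ
    have h1 : (fun i => boolSign (ξ i) * x i) = hd (sg ξ) + tl (sg ξ) := by
      ext i
      by_cases h : blk i = 0 <;> simp [hd, tl, h, hsg, mul_comm]
    have h2 : G (hd (sg ξ) + tl (sg ξ)) (hd (sg ξ) + tl (sg ξ)) =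
        G (hd (sg ξ)) (hd (sg ξ)) + ∑ i, tl (sg ξ) i ^ 2 * γ i i + X ξ + Q ξ := by
      simp only [map_add, LinearMap.add_apply, hQ, hCquad, hX]
      rw [hsymm (hd (sg ξ)) (tl (sg ξ))]; ring
    have h3 : |G (hd (sg ξ)) (hd (sg ξ))| ≤ δ * ∑ i, hd (sg ξ) i ^ 2 := by
      calc _ ≤ δ * blockNorm blk (hd (sg ξ)) * blockNorm blk (hd (sg ξ)) := hbil _ _
        _ ≤ δ * √(∑ i, hd (sg ξ) i ^ 2) * √(∑ i, hd (sg ξ) i ^ 2) := by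
          gcongr; exacts [hn _, hhdnorm ξ, hhdnorm ξ]
        _ = _ := by
          rw [mul_assoc, Real.mul_self_sqrt (Finset.sum_nonneg fun i _ => sq_nonneg _)]
    have h4 := hdiagsum (sg ξ)
    have h5 := hsgsq ξ
    rw [h1, h2]
    calc _ ≤ |G (hd (sg ξ)) (hd (sg ξ))| + |∑ i, tl (sg ξ) i ^ 2 * γ i i| + |X ξ| + |Q ξ| :=
          (abs_add_le _ _).trans (add_le_add_left ((abs_add_le _ _).trans
            (add_le_add_left (abs_add_le _ _) _)) _)
      _ ≤ δ * ∑ i, hd (sg ξ) i ^ 2 + δ * ∑ i, tl (sg ξ) i ^ 2 + |X ξ| + |Q ξ| := by gcongr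
      _ = _ := by rw [← mul_add, h5, mul_one]
  set l : ℝ := s / (8 * δ) with hl
  have hlpos : 0 < l := by positivity
  have hQmgf : ∀ τ : ℝ, τ ^ 2 = 1 → ∑ ξ, Real.exp (τ * l * Q ξ) ≤ 2 ^ N * Real.exp (s / 32) := by
    intro τ hτ
    have hτ' : |τ| = 1 := by rw [← sq_eq_sq₀ (abs_nonneg _) zero_le_one, sq_abs, hτ, one_pow]
    have hquad : ∀ y : Fin N → ℝ, ∑ i, ∑ j, 2 * τ * l * C i j * y i * y j =
        2 * τ * l * ∑ i, ∑ j, C i j * y i * y j := by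
      intro y
      simp only [Finset.mul_sum, mul_assoc]
    have := sum_exp_quadratic_rademacher_le (β := 1 / 2) (by norm_num)
      (fun i j => 2 * τ * l * C i j) ?_ ?_ ?_
    · refine le_trans (le_of_eq ?_) (this.trans ?_)
      · refine Finset.sum_congr rfl fun ξ _ => ?_
        rw [hquad]
        congr 1
        simp only [hQ, hsg]; ring
      · refine mul_le_mul_of_nonneg_left (Real.exp_le_exp.2 ?_) (by positivity)
        have h0 : ∑ i, 2 * τ * l * C i i = 0 :=
          Finset.sum_eq_zero fun i _ => by simp [hC]
        have h1 : ∑ i, ∑ j, (2 * τ * l * C i j) ^ 2 = 4 * l ^ 2 * ∑ i, ∑ j, C i j ^ 2 := by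
          simp only [mul_pow, hτ, Finset.mul_sum]
          norm_num
        rw [h0, h1]
        calc _ ≤ 0 / 2 + 4 * l ^ 2 * (δ ^ 2 / s) / (4 * (1 - 1 / 2)) := by gcongr
          _ = _ := by rw [hl]; field_simp; ring
    · intro i j
      have : C i j = C j i := by
        simp only [hC, hγ]
        rw [hsymm (Pi.single i 1)]
        by_cases h : blk i = 0 ∨ blk j = 0 ∨ i = j
        · have h' : blk j = 0 ∨ blk i = 0 ∨ j = i := by tauto
          simp only [h, h', if_true]
        · have h' : ¬ (blk j = 0 ∨ blk i = 0 ∨ j = i) := by tauto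
          simp only [h, h', if_false]; ring
      rw [this]
    · intro i
      simp [hC]
    · intro y
      rw [hquad]
      calc _ ≤ |2 * τ * l * ∑ i, ∑ j, C i j * y i * y j| := le_abs_self _
        _ = 2 * l * |∑ i, ∑ j, C i j * y i * y j| := by
          rw [abs_mul, abs_mul, abs_mul, hτ', abs_of_pos hlpos, abs_two]; ring
        _ ≤ 2 * l * (2 * δ / s * ∑ i, y i ^ 2) := by gcongr; exact hop y
        _ = _ := by rw [hl]; field_simp; norm_num
  have hXmgf : ∀ τ : ℝ, τ ^ 2 = 1 → ∑ ξ, Real.exp (τ * l * X ξ) ≤ 2 ^ N * Real.exp (s / 32) := by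
    intro τ hτ
    have hmix := sum_sum_mix (fun i => blk i = 0) fun ξ => Real.exp (τ * l * X ξ)
    have hin : ∀ ξ : Fin N → Bool, ∑ η : Fin N → Bool,
        Real.exp (τ * l * X (fun i => if blk i = 0 then ξ i else η i)) ≤
        2 ^ N * Real.exp (s / 32) := by
      intro ξ
      set c : Fin N → ℝ := fun i => 2 * τ * l *
        (if blk i = 0 then 0 else x i * G (Pi.single i 1) (hd (sg ξ))) with hc
      have h1 : ∀ η : Fin N → Bool, τ * l * X (fun i => if blk i = 0 then ξ i else η i) =
          ∑ i, boolSign (η i) * c i := by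
        intro η
        have e1 : hd (sg fun i => if blk i = 0 then ξ i else η i) = hd (sg ξ) := by
          ext i; by_cases h : blk i = 0 <;> simp [hd, hsg, h]
        have e2 : tl (sg fun i => if blk i = 0 then ξ i else η i) = tl (sg η) := by
          ext i; by_cases h : blk i = 0 <;> simp [tl, hsg, h]
        simp only [hX]
        rw [e1, e2, bilin_left_eq_sum, Finset.mul_sum, Finset.mul_sum]
        refine Finset.sum_congr rfl fun i _ => ?_
        by_cases h : blk i = 0
        · simp [tl, hc, h]
        · simp only [tl, hc, h, if_false, hsg]; ring
      simp only [h1]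
      refine (sum_exp_rademacher_le c).trans ?_
      refine mul_le_mul_of_nonneg_left (Real.exp_le_exp.2 ?_) (by positivity)
      have h2 : ∑ i, c i ^ 2 = 4 * l ^ 2 *
          ∑ i, (if blk i = 0 then 0 else x i * G (Pi.single i 1) (hd (sg ξ))) ^ 2 := by
        rw [Finset.mul_sum]
        refine Finset.sum_congr rfl fun i _ => ?_
        simp only [hc]
        rw [mul_pow, mul_pow, mul_pow, hτ]; ring
      have h3 := hentries (hd (sg ξ)) ((hhdnorm ξ).trans (Real.sqrt_le_one.2 (hhdle ξ)))
      rw [h2]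
      calc _ ≤ 4 * l ^ 2 * (δ ^ 2 / s) / 2 := by gcongr
        _ = _ := by rw [hl]; field_simp; norm_num
    have h2 : (2 : ℝ) ^ N * ∑ ξ, Real.exp (τ * l * X ξ) ≤
        2 ^ N * (2 ^ N * Real.exp (s / 32)) := by
      rw [← hmix]
      refine (Finset.sum_le_sum fun ξ _ => hin ξ).trans (le_of_eq ?_)
      simp
    exact le_of_mul_le_mul_left h2 (by positivity)
  have hmarkov : ∀ ξ, ¬ |G (fun i => boolSign (ξ i) * x i) (fun i => boolSign (ξ i) * x i)| ≤
      4 * δ → Real.exp (3 * s / 16) ≤ Real.exp (1 * l * X ξ) + Real.exp (-1 * l * X ξ) +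
        Real.exp (1 * l * Q ξ) + Real.exp (-1 * l * Q ξ) := by
    intro ξ hξ
    have h1 := hdecomp ξ
    have hle : l * (3 / 2 * δ) = 3 * s / 16 := by rw [hl]; field_simp; norm_num
    have hcase : ∀ Y : ℝ, 3 / 2 * δ ≤ |Y| →
        Real.exp (3 * s / 16) ≤ Real.exp (1 * l * Y) + Real.exp (-1 * l * Y) := by
      intro Y hY
      rw [← hle]
      rcases le_abs.1 hY with h | h
      · have : Real.exp (l * (3 / 2 * δ)) ≤ Real.exp (1 * l * Y) := by
          rw [one_mul]; gcongr
        linarith [Real.exp_pos (-1 * l * Y)]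
      · have : Real.exp (l * (3 / 2 * δ)) ≤ Real.exp (-1 * l * Y) := by
          rw [show -1 * l * Y = l * (-Y) by ring]; gcongr
        linarith [Real.exp_pos (1 * l * Y)]
    rcases le_or_gt (3 / 2 * δ) |X ξ| with h | h
    · linarith [hcase _ h, Real.exp_pos (1 * l * Q ξ), Real.exp_pos (-1 * l * Q ξ)]
    · have h' : 3 / 2 * δ ≤ |Q ξ| := by linarith [not_le.1 hξ]
      linarith [hcase _ h', Real.exp_pos (1 * l * X ξ), Real.exp_pos (-1 * l * X ξ)]
  set S := Finset.univ.filter fun ξ : Fin N → Bool =>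
      ¬ |G (fun i => boolSign (ξ i) * x i) (fun i => boolSign (ξ i) * x i)| ≤ 4 * δ with hS
  have hsum : (S.card : ℝ) * Real.exp (3 * s / 16) ≤ 4 * (2 ^ N * Real.exp (s / 32)) := by
    calc (S.card : ℝ) * Real.exp (3 * s / 16) = ∑ _ξ ∈ S, Real.exp (3 * s / 16) := by simp
      _ ≤ ∑ ξ ∈ S, (Real.exp (1 * l * X ξ) + Real.exp (-1 * l * X ξ) +
        Real.exp (1 * l * Q ξ) + Real.exp (-1 * l * Q ξ)) :=
        Finset.sum_le_sum fun ξ hξ => hmarkov ξ (Finset.mem_filter.1 hξ).2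
      _ ≤ ∑ ξ, (Real.exp (1 * l * X ξ) + Real.exp (-1 * l * X ξ) +
        Real.exp (1 * l * Q ξ) + Real.exp (-1 * l * Q ξ)) :=
        Finset.sum_le_univ_sum_of_nonneg fun ξ => by positivity
      _ ≤ _ := by
        rw [Finset.sum_add_distrib, Finset.sum_add_distrib, Finset.sum_add_distrib]
        linarith [hXmgf 1 (by norm_num), hXmgf (-1) (by norm_num), hQmgf 1 (by norm_num),
          hQmgf (-1) (by norm_num)]
  rw [← le_div_iff₀ (Real.exp_pos _), mul_div_assoc, mul_div_assoc, ← Real.exp_sub] at hsum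
  refine hsum.trans (le_of_eq ?_)
  rw [show (s : ℝ) / 32 - 3 * s / 16 = -(5 / 32 * s) by ring]; ring

/-- The Krahmer–Ward concentration inequality. -/
lemma card_large_quadratic_rademacher_le {N s : ℕ} {δ : ℝ} (hs : 0 < s) (hδ : 0 < δ)
    (G : LinearMap.BilinForm ℝ (Fin N → ℝ)) (hsymm : ∀ u v, G u v = G v u)
    (hG : ∀ w : Fin N → ℝ, Set.ncard {i | w i ≠ 0} ≤ 2 * s → |G w w| ≤ δ * ∑ i, w i ^ 2)
    (x : Fin N → ℝ) :
    ((Finset.univ.filter fun ξ : Fin N → Bool =>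
      ¬ |G (fun i => boolSign (ξ i) * x i) (fun i => boolSign (ξ i) * x i)| ≤
        4 * δ * ∑ i, x i ^ 2).card : ℝ) ≤ 2 ^ N * (4 * Real.exp (-(5 / 32 * s))) := by
  have hnn : 0 ≤ ∑ i, x i ^ 2 := Finset.sum_nonneg fun i _ => sq_nonneg _
  rcases hnn.eq_or_lt with h0 | hpos
  · have hx : x = 0 := by
      ext i
      have := (Finset.sum_eq_zero_iff_of_nonneg fun i _ => sq_nonneg (x i)).1 h0.symm i
        (Finset.mem_univ i)
      simpa using this
    subst hx
    have : (fun _ : Fin N => (0 : ℝ)) = 0 := rfl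
    simp only [Pi.zero_apply, mul_zero, this]
    simp
    positivity
  · set a := √(∑ i, x i ^ 2) with ha
    have hapos : 0 < a := Real.sqrt_pos.2 hpos
    have ha2 : a ^ 2 = ∑ i, x i ^ 2 := Real.sq_sqrt hnn
    have key := card_large_quadratic_rademacher_le_of_unit hs hδ G hsymm hG (a⁻¹ • x) (by
      simp only [Pi.smul_apply, smul_eq_mul, mul_pow, ← Finset.mul_sum, ← ha2]
      field_simp)
    refine le_trans ?_ key
    refine Nat.cast_le.2 (Finset.card_le_card (Finset.monotone_filter_right _ ?_))
    intro ξ _ hξ h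
    refine hξ ?_
    have e : (fun i => boolSign (ξ i) * (a⁻¹ • x) i) = a⁻¹ • fun i => boolSign (ξ i) * x i := by
      ext i; simp only [Pi.smul_apply, smul_eq_mul]; ring
    rw [e, map_smul, map_smul, LinearMap.smul_apply, smul_eq_mul, smul_eq_mul, ← mul_assoc,
      abs_mul, abs_of_pos (by positivity : 0 < a⁻¹ * a⁻¹)] at h
    rw [← ha2]
    calc _ = a ^ 2 * (a⁻¹ * a⁻¹ * |G (fun i => boolSign (ξ i) * x i)
            (fun i => boolSign (ξ i) * x i)|) := by field_simp
      _ ≤ a ^ 2 * (4 * δ) := by gcongr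
      _ = _ := by ring

/-- A finite set of separated points in the unit ball of a finite-dimensional space. -/
lemma card_le_of_separated_unit_ball {E : Type*} [NormedAddCommGroup E] [NormedSpace ℝ E]
    [FiniteDimensional ℝ E] (T : Finset E) (hT : ∀ c ∈ T, ‖c‖ ≤ 1)
    (h : ∀ c ∈ T, ∀ d ∈ T, c ≠ d → 1 / 4 ≤ ‖c - d‖) : T.card ≤ 9 ^ Module.finrank ℝ E := by
  borelize E
  let μ : MeasureTheory.Measure E := MeasureTheory.Measure.addHaar
  set A := ⋃ c ∈ T, Metric.ball (c : E) (1 / 8) with hA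
  have D : Set.Pairwise (T : Set E)
      (Function.onFun Disjoint fun c => Metric.ball (c : E) (1 / 8)) := by
    rintro c hc d hd hcd
    apply Metric.ball_disjoint_ball
    rw [dist_eq_norm]
    exact le_trans (by norm_num) (h c hc d hd hcd)
  have hsub : A ⊆ Metric.ball (0 : E) (9 / 8) := by
    refine Set.iUnion₂_subset fun x hx => ?_
    apply Metric.ball_subset_ball'
    rw [dist_zero_right]
    linarith [hT x hx]
  have I : (T.card : ENNReal) * ENNReal.ofReal ((1 / 8) ^ Module.finrank ℝ E) *
        μ (Metric.ball 0 1) ≤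
      ENNReal.ofReal ((9 / 8) ^ Module.finrank ℝ E) * μ (Metric.ball 0 1) :=
    calc
      _ = μ A := by
        rw [hA, MeasureTheory.measure_biUnion_finset D fun c _ => measurableSet_ball]
        simp only [μ.addHaar_ball_of_pos _ (show (0 : ℝ) < 1 / 8 by norm_num)]
        simp only [Finset.sum_const, nsmul_eq_mul, mul_assoc]
      _ ≤ μ (Metric.ball (0 : E) (9 / 8)) := MeasureTheory.measure_mono hsub
      _ = _ := by simp only [μ.addHaar_ball_of_pos _ (show (0 : ℝ) < 9 / 8 by norm_num)]
  have J : (T.card : ENNReal) * ENNReal.ofReal ((1 / 8) ^ Module.finrank ℝ E) ≤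
      ENNReal.ofReal ((9 / 8) ^ Module.finrank ℝ E) :=
    (ENNReal.mul_le_mul_iff_left (Metric.measure_ball_pos _ _ zero_lt_one).ne'
      MeasureTheory.measure_ball_lt_top.ne).1 I
  have K : (T.card : ℝ) ≤ (9 : ℝ) ^ Module.finrank ℝ E := by
    have := ENNReal.toReal_le_of_le_ofReal (by positivity) J
    simpa [div_eq_mul_inv, mul_pow] using this
  exact_mod_cast K

lemma exists_net_unit_ball (E : Type*) [NormedAddCommGroup E] [NormedSpace ℝ E]
    [FiniteDimensional ℝ E] : ∃ T : Finset E, T.card ≤ 9 ^ Module.finrank ℝ E ∧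
      (∀ y ∈ T, ‖y‖ ≤ 1) ∧ ∀ x : E, ‖x‖ ≤ 1 → ∃ y ∈ T, ‖x - y‖ ≤ 1 / 4 := by
  set P : ℕ → Prop := fun k => ∃ T : Finset E, T.card = k ∧ (∀ c ∈ T, ‖c‖ ≤ 1) ∧
    ∀ c ∈ T, ∀ d ∈ T, c ≠ d → 1 / 4 ≤ ‖c - d‖
  have hbound : ∀ k, P k → k ≤ 9 ^ Module.finrank ℝ E := by
    rintro k ⟨T, rfl, h1, h2⟩
    exact card_le_of_separated_unit_ball T h1 h2
  have h0 : P 0 := ⟨∅, by simp⟩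
  have hspec : P (Nat.findGreatest P (9 ^ Module.finrank ℝ E)) :=
    Nat.findGreatest_spec (Nat.zero_le _) h0
  obtain ⟨T, hcard, h1, h2⟩ := hspec
  refine ⟨T, card_le_of_separated_unit_ball T h1 h2, h1, fun x hx => ?_⟩
  by_contra! hcon
  have hxT : x ∉ T := fun h => by
    have := hcon x h
    norm_num at this
  have hP : P (T.card + 1) := by
    refine ⟨insert x T, Finset.card_insert_of_notMem hxT, ?_, ?_⟩
    · intro c hc
      rcases Finset.mem_insert.1 hc with rfl | hc
      exacts [hx, h1 c hc]
    · intro c hc d hd hcd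
      rcases Finset.mem_insert.1 hc with rfl | hc' <;> rcases Finset.mem_insert.1 hd with rfl | hd'
      · exact absurd rfl hcd
      · exact (hcon d hd').le
      · rw [norm_sub_rev]; exact (hcon c hc').le
      · exact h2 c hc' d hd' hcd
  have hlt := Nat.le_findGreatest (hbound _ hP) hP
  rw [← hcard] at hlt
  exact Nat.not_succ_le_self _ hlt

/-- Distortion bounds on a net of the unit ball extend to the whole space. -/
lemma exists_net_distortion (E : Type*) [NormedAddCommGroup E] [InnerProductSpace ℝ E]
    [FiniteDimensional ℝ E] : ∃ T : Finset E, T.card ≤ 9 ^ Module.finrank ℝ E ∧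
      ∀ {F : Type} [NormedAddCommGroup F] [InnerProductSpace ℝ F] (L : E →ₗ[ℝ] F) (η : ℝ),
        0 ≤ η → (∀ y ∈ T, |‖L y‖ ^ 2 - ‖y‖ ^ 2| ≤ η * ‖y‖ ^ 2) →
        ∀ x, |‖L x‖ ^ 2 - ‖x‖ ^ 2| ≤ 2 * η * ‖x‖ ^ 2 := by
  obtain ⟨T, hcard, hT, hnet⟩ := exists_net_unit_ball E
  refine ⟨T, hcard, fun {F} _ _ L η hη hy => ?_⟩
  have hL : Continuous L := L.continuous_of_finiteDimensional
  have : ProperSpace E := FiniteDimensional.proper_real E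
  obtain ⟨x₀, hx₀, hmax⟩ := (isCompact_closedBall (0 : E) 1).exists_isMaxOn ⟨0, by simp⟩
    (f := fun x => |‖L x‖ ^ 2 - ‖x‖ ^ 2|) (by fun_prop)
  set μ := |‖L x₀‖ ^ 2 - ‖x₀‖ ^ 2| with hμ
  have hμ0 : 0 ≤ μ := abs_nonneg _
  have hall : ∀ x, |‖L x‖ ^ 2 - ‖x‖ ^ 2| ≤ μ * ‖x‖ ^ 2 := by
    intro x
    by_cases hx : x = 0
    · simp [hx]
    have hpos : 0 < ‖x‖ := norm_pos_iff.2 hx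
    have h1 := hmax (a := ‖x‖⁻¹ • x) (by
      rw [mem_closedBall_zero_iff, norm_smul, norm_inv, norm_norm, inv_mul_cancel₀ hpos.ne'])
    simp only [Set.mem_ofPred_eq, map_smul, norm_smul, norm_inv, norm_norm, mul_pow, ← mul_sub,
      abs_mul, abs_of_pos (show 0 < ‖x‖⁻¹ ^ 2 by positivity)] at h1
    rw [inv_pow, inv_mul_le_iff₀ (by positivity), mul_comm] at h1
    exact h1
  have hpol : ∀ u v : E, |inner ℝ (L u) (L v) - inner ℝ u v| ≤ μ / 2 * (‖u‖ ^ 2 + ‖v‖ ^ 2) := by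
    intro u v
    have h1 := abs_le.1 (hall (u + v))
    have h2 := abs_le.1 (hall (u - v))
    rw [map_add, norm_add_sq_real, norm_add_sq_real] at h1
    rw [map_sub, norm_sub_sq_real, norm_sub_sq_real] at h2
    rw [abs_le]
    constructor <;> nlinarith
  have hμle : μ ≤ 2 * η := by
    have hx1 : ‖x₀‖ ≤ 1 := by simpa using hx₀
    obtain ⟨y, hyT, hxy⟩ := hnet x₀ hx1
    have hy1 := hT y hyT
    have h1 := hpol ((8 : ℝ) • (x₀ - y)) (x₀ + y)
    have hn1 : ‖(8 : ℝ) • (x₀ - y)‖ ^ 2 ≤ 4 := by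
      rw [norm_smul]; norm_num
      nlinarith [norm_nonneg (x₀ - y)]
    have hn2 : ‖x₀ + y‖ ^ 2 ≤ 4 := by
      nlinarith [norm_add_le x₀ y, norm_nonneg (x₀ + y)]
    have e1 : inner ℝ (L ((8 : ℝ) • (x₀ - y))) (L (x₀ + y)) - inner ℝ ((8 : ℝ) • (x₀ - y)) (x₀ + y)
        = 8 * ((‖L x₀‖ ^ 2 - ‖x₀‖ ^ 2) - (‖L y‖ ^ 2 - ‖y‖ ^ 2)) := by
      simp only [map_smul, map_sub, map_add, real_inner_smul_left, inner_sub_left, inner_add_right,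
        real_inner_self_eq_norm_sq, real_inner_comm (L x₀) (L y), real_inner_comm x₀ y]
      ring
    rw [e1, abs_mul] at h1
    norm_num at h1
    have h2 := hy y hyT
    have h3 : η * ‖y‖ ^ 2 ≤ η := by
      have hy2 : ‖y‖ ^ 2 ≤ 1 := by nlinarith [norm_nonneg y]
      nlinarith [norm_nonneg y, mul_le_mul_of_nonneg_left hy2 hη]
    have h4 : μ ≤ |(‖L x₀‖ ^ 2 - ‖x₀‖ ^ 2) - (‖L y‖ ^ 2 - ‖y‖ ^ 2)| + |‖L y‖ ^ 2 - ‖y‖ ^ 2| := by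
      have := abs_add_le ((‖L x₀‖ ^ 2 - ‖x₀‖ ^ 2) - (‖L y‖ ^ 2 - ‖y‖ ^ 2)) (‖L y‖ ^ 2 - ‖y‖ ^ 2)
      rwa [sub_add_cancel] at this
    nlinarith
  intro x
  exact (hall x).trans (mul_le_mul_of_nonneg_right hμle (sq_nonneg _))

lemma nsq_nonneg {n : ℕ} (x : Fin n → ℂ) : 0 ≤ nsq x :=
  Finset.sum_nonneg fun _ _ => sq_nonneg _

lemma nsq_eq_re_im {n : ℕ} (x : Fin n → ℂ) :
    nsq x = ∑ i, (x i).re ^ 2 + ∑ i, (x i).im ^ 2 := by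
  rw [nsq, ← Finset.sum_add_distrib]
  refine Finset.sum_congr rfl fun i _ => ?_
  rw [Complex.sq_norm, Complex.normSq_apply]; ring

lemma nsq_map_mulVec {m N : ℕ} (B : Matrix (Fin m) (Fin N) ℝ) (x : Fin N → ℂ) :
    nsq ((B.map (fun a => (a : ℂ))).mulVec x) =
      ∑ i, (B.mulVec (fun j => (x j).re) i) ^ 2 + ∑ i, (B.mulVec (fun j => (x j).im) i) ^ 2 := by
  rw [nsq_eq_re_im]
  congr 1 <;>
  · refine Finset.sum_congr rfl fun i _ => ?_
    simp [Matrix.mulVec, dotProduct]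

/-- The distortion of squared norms by a real matrix, as a bilinear form. -/
noncomputable def distortion {m N : ℕ} (B : Matrix (Fin m) (Fin N) ℝ) :
    LinearMap.BilinForm ℝ (Fin N → ℝ) :=
  LinearMap.mk₂ ℝ (fun u v => B.mulVec u ⬝ᵥ B.mulVec v - u ⬝ᵥ v)
    (fun a b c => by rw [Matrix.mulVec_add, add_dotProduct, add_dotProduct]; ring)
    (fun a b c => by rw [Matrix.mulVec_smul, smul_dotProduct, smul_dotProduct, smul_sub])
    (fun a b c => by rw [Matrix.mulVec_add, dotProduct_add, dotProduct_add]; ring)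
    (fun a b c => by rw [Matrix.mulVec_smul, dotProduct_smul, dotProduct_smul, smul_sub])

lemma distortion_self {m N : ℕ} (B : Matrix (Fin m) (Fin N) ℝ) (w : Fin N → ℝ) :
    distortion B w w = ∑ i, (B.mulVec w i) ^ 2 - ∑ i, w i ^ 2 := by
  simp [distortion, dotProduct, pow_two]

lemma nsq_map_mulVec_sub {m N : ℕ} (B : Matrix (Fin m) (Fin N) ℝ) (x : Fin N → ℂ) :
    nsq ((B.map (fun a => (a : ℂ))).mulVec x) - nsq x =
      distortion B (fun j => (x j).re) (fun j => (x j).re) +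
        distortion B (fun j => (x j).im) (fun j => (x j).im) := by
  rw [nsq_map_mulVec, nsq_eq_re_im, distortion_self, distortion_self]; ring

lemma abs_distortion_le_of_RIPr {m N : ℕ} {B : Matrix (Fin m) (Fin N) ℝ} {S δ : ℝ}
    (hB : RIPr B S δ) (w : Fin N → ℝ) (hw : (Set.ncard {i | w i ≠ 0} : ℝ) ≤ S) :
    |distortion B w w| ≤ δ * ∑ i, w i ^ 2 := by
  have h := hB (fun i => (w i : ℂ)) (by simpa using hw)
  have e : nsq (fun i => (w i : ℂ)) = ∑ i, w i ^ 2 := by simp [nsq_eq_re_im]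
  have e2 : nsq ((B.map (fun a => (a : ℂ))).mulVec fun i => (w i : ℂ)) =
      ∑ i, (B.mulVec w i) ^ 2 := by
    rw [nsq_map_mulVec]
    simp [Matrix.mulVec, dotProduct]
  rw [e, e2] at h
  rw [distortion_self, abs_le]
  constructor <;> linarith [h.1, h.2]

/-- A matrix with the restricted isometry property and random column signs nearly preserves the
norm of a fixed complex vector with high probability. -/
lemma card_large_distortion_le {m N s : ℕ} {δ S : ℝ} (hs : 0 < s) (hδ : 0 < δ)
    {B : Matrix (Fin m) (Fin N) ℝ} (hB : RIPr B S δ) (hS : (2 * s : ℝ) ≤ S) (x : Fin N → ℂ) :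
    ((Finset.univ.filter fun ξ : Fin N → Bool =>
      ¬ |nsq (((B * diagSign ξ).map (fun a => (a : ℂ))).mulVec x) - nsq x| ≤
        4 * δ * nsq x).card : ℝ) ≤ 2 ^ N * (8 * Real.exp (-(5 / 32 * s))) := by
  have hsymm : ∀ u v, distortion B u v = distortion B v u := fun u v => by
    simp [distortion, dotProduct_comm]
  have hG : ∀ w : Fin N → ℝ, Set.ncard {i | w i ≠ 0} ≤ 2 * s →
      |distortion B w w| ≤ δ * ∑ i, w i ^ 2 := fun w hw =>
    abs_distortion_le_of_RIPr hB w (le_trans (by exact_mod_cast hw) hS)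
  have h1 := card_large_quadratic_rademacher_le hs hδ (distortion B) hsymm hG fun j => (x j).re
  have h2 := card_large_quadratic_rademacher_le hs hδ (distortion B) hsymm hG fun j => (x j).im
  have hmul : ∀ (ξ : Fin N → Bool) (w : Fin N → ℝ),
      distortion (B * diagSign ξ) w w =
        distortion B (fun i => boolSign (ξ i) * w i) (fun i => boolSign (ξ i) * w i) := by
    intro ξ w
    rw [distortion_self, distortion_self, ← Matrix.mulVec_mulVec]
    have e : (diagSign ξ).mulVec w = fun i => boolSign (ξ i) * w i := by
      ext i
      simp [diagSign, Matrix.mulVec_diagonal, boolSign]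
    rw [e]
    simp [mul_pow, boolSign_sq]
  calc _ ≤ (((Finset.univ.filter fun ξ : Fin N → Bool =>
      ¬ |distortion B (fun i => boolSign (ξ i) * (x i).re) (fun i => boolSign (ξ i) * (x i).re)| ≤
        4 * δ * ∑ i, (x i).re ^ 2) ∪ (Finset.univ.filter fun ξ : Fin N → Bool =>
      ¬ |distortion B (fun i => boolSign (ξ i) * (x i).im) (fun i => boolSign (ξ i) * (x i).im)| ≤
        4 * δ * ∑ i, (x i).im ^ 2)).card : ℝ) := by
        refine Nat.cast_le.2 (Finset.card_le_card fun ξ hξ => ?_)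
        rw [Finset.mem_filter] at hξ
        simp only [Finset.mem_union, Finset.mem_filter, Finset.mem_univ, true_and]
        by_contra! hcon
        refine hξ.2 ?_
        rw [nsq_map_mulVec_sub, hmul, hmul, nsq_eq_re_im, mul_add]
        exact (abs_add_le _ _).trans (add_le_add hcon.1 hcon.2)
    _ ≤ _ := by
      refine (Nat.cast_le.2 (Finset.card_union_le _ _)).trans ?_
      push_cast
      calc _ ≤ _ := add_le_add h1 h2
        _ = _ := by ring

lemma ofReal_nsq {n : ℕ} (x : Fin n → ℂ) : (nsq x : ℂ) = ∑ i, (starRingEnd ℂ) (x i) * x i := by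
  rw [nsq]
  push_cast
  refine Finset.sum_congr rfl fun i _ => ?_
  rw [mul_comm, Complex.mul_conj, ← Complex.sq_norm, Complex.ofReal_pow]

lemma nsq_sum_orthonormal {r N : ℕ} {w : Fin r → Fin N → ℂ}
    (hw : ∀ i j, ∑ k, (starRingEnd ℂ) (w i k) * w j k = if i = j then 1 else 0) (a : Fin r → ℂ) :
    nsq (∑ j, a j • w j) = nsq a := by
  have h : (nsq (∑ j, a j • w j) : ℂ) = nsq a := by
    rw [ofReal_nsq, ofReal_nsq]
    calc _ = ∑ k, ∑ i, ∑ j, (starRingEnd ℂ) (a i) * a j * ((starRingEnd ℂ) (w i k) * w j k) := by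
          refine Finset.sum_congr rfl fun k _ => ?_
          simp only [Finset.sum_apply, Pi.smul_apply, smul_eq_mul, map_sum, map_mul,
            Finset.sum_mul_sum]
          exact Finset.sum_congr rfl fun i _ => Finset.sum_congr rfl fun j _ => by ring
      _ = ∑ i, ∑ j, (starRingEnd ℂ) (a i) * a j * ∑ k, (starRingEnd ℂ) (w i k) * w j k := by
          rw [Finset.sum_comm]
          refine Finset.sum_congr rfl fun i _ => ?_
          rw [Finset.sum_comm]
          exact Finset.sum_congr rfl fun j _ => by rw [Finset.mul_sum]
      _ = _ := by simp [hw]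
  exact_mod_cast h

lemma norm_toLp_sq_eq_nsq {n : ℕ} (x : Fin n → ℂ) : ‖WithLp.toLp 2 x‖ ^ 2 = nsq x := by
  rw [EuclideanSpace.norm_sq_eq]; rfl

lemma exists_net_distortion_span {r N : ℕ} {w : Fin r → Fin N → ℂ}
    (hw : ∀ i j, ∑ k, (starRingEnd ℂ) (w i k) * w j k = if i = j then 1 else 0) :
    ∃ T : Finset (Fin N → ℂ), T.card ≤ 9 ^ (2 * r) ∧
      ∀ {m : ℕ} (M : Matrix (Fin m) (Fin N) ℝ) (η : ℝ), 0 ≤ η →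
        (∀ y ∈ T, |nsq ((M.map (fun a => (a : ℂ))).mulVec y) - nsq y| ≤ η * nsq y) →
        ∀ a : Fin r → ℂ,
          |nsq ((M.map (fun a => (a : ℂ))).mulVec (∑ j, a j • w j)) - nsq (∑ j, a j • w j)| ≤
            2 * η * nsq (∑ j, a j • w j) := by
  obtain ⟨T, hcard, hT⟩ := exists_net_distortion (EuclideanSpace ℂ (Fin r))
  have hfin : Module.finrank ℝ (EuclideanSpace ℂ (Fin r)) = 2 * r := by
    rw [finrank_real_of_complex]; simp
  refine ⟨T.image fun a => ∑ j, a j • w j, Finset.card_image_le.trans (hfin ▸ hcard),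
    fun {m} M η hη hy a => ?_⟩
  let L : EuclideanSpace ℂ (Fin r) →ₗ[ℝ] EuclideanSpace ℂ (Fin m) :=
    { toFun := fun a => WithLp.toLp 2 ((M.map (fun a => (a : ℂ))).mulVec (∑ j, a j • w j))
      map_add' := fun a b => by
        have : ∑ j, (a + b) j • w j = ∑ j, a j • w j + ∑ j, b j • w j := by
          simp [add_smul, Finset.sum_add_distrib]
        rw [this, Matrix.mulVec_add]; rfl
      map_smul' := fun c a => by
        have : ∑ j, (c • a) j • w j = c • ∑ j, a j • w j := by
          rw [Finset.smul_sum]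
          exact Finset.sum_congr rfl fun j _ => by
            rw [PiLp.smul_apply, smul_assoc]
        rw [this, Matrix.mulVec_smul]; rfl }
  have hL : ∀ b : EuclideanSpace ℂ (Fin r), ‖L b‖ ^ 2 =
      nsq ((M.map (fun a => (a : ℂ))).mulVec (∑ j, b j • w j)) := fun b =>
    norm_toLp_sq_eq_nsq _
  have hn : ∀ b : EuclideanSpace ℂ (Fin r), ‖b‖ ^ 2 = nsq (∑ j, b j • w j) := fun b => by
    rw [nsq_sum_orthonormal hw, EuclideanSpace.norm_sq_eq]; rfl
  have key := hT L η hη (fun y hyT => by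
    rw [hL, hn]
    exact hy _ (Finset.mem_image_of_mem _ hyT)) (WithLp.toLp 2 a)
  rwa [hL, hn] at key

/-- A matrix with the restricted isometry property and random column signs nearly preserves norms
on a fixed subspace with high probability. -/
lemma card_large_distortion_span_le {m N s r : ℕ} {δ S : ℝ} (hs : 0 < s) (hδ : 0 < δ)
    {B : Matrix (Fin m) (Fin N) ℝ} (hB : RIPr B S δ) (hS : (2 * s : ℝ) ≤ S)
    {w : Fin r → Fin N → ℂ}
    (hw : ∀ i j, ∑ k, (starRingEnd ℂ) (w i k) * w j k = if i = j then 1 else 0) :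
    ((Finset.univ.filter fun ξ : Fin N → Bool => ¬ ∀ a : Fin r → ℂ,
      |nsq (((B * diagSign ξ).map (fun a => (a : ℂ))).mulVec (∑ j, a j • w j)) -
        nsq (∑ j, a j • w j)| ≤ 8 * δ * nsq (∑ j, a j • w j)).card : ℝ) ≤
      2 ^ N * (9 ^ (2 * r) * (8 * Real.exp (-(5 / 32 * s)))) := by
  obtain ⟨T, hcard, hT⟩ := exists_net_distortion_span hw
  calc _ ≤ ((T.biUnion fun y => Finset.univ.filter fun ξ : Fin N → Bool =>
      ¬ |nsq (((B * diagSign ξ).map (fun a => (a : ℂ))).mulVec y) - nsq y| ≤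
        4 * δ * nsq y).card : ℝ) := by
        refine Nat.cast_le.2 (Finset.card_le_card fun ξ hξ => ?_)
        rw [Finset.mem_filter] at hξ
        by_contra hcon
        refine hξ.2 fun a => ?_
        have := hT (B * diagSign ξ) (4 * δ) (by positivity) (fun y hy => ?_) a
        · rwa [show 2 * (4 * δ) = 8 * δ by ring] at this
        · by_contra h
          exact hcon (Finset.mem_biUnion.2 ⟨y, hy, Finset.mem_filter.2 ⟨Finset.mem_univ _, h⟩⟩)
    _ ≤ ∑ y ∈ T, ((Finset.univ.filter fun ξ : Fin N → Bool =>
      ¬ |nsq (((B * diagSign ξ).map (fun a => (a : ℂ))).mulVec y) - nsq y| ≤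
        4 * δ * nsq y).card : ℝ) := by
        exact_mod_cast Finset.card_biUnion_le
    _ ≤ ∑ _y ∈ T, 2 ^ N * (8 * Real.exp (-(5 / 32 * s))) :=
        Finset.sum_le_sum fun y _ => card_large_distortion_le hs hδ hB hS y
    _ = T.card * (2 ^ N * (8 * Real.exp (-(5 / 32 * s)))) := by simp
    _ ≤ 9 ^ (2 * r) * (2 ^ N * (8 * Real.exp (-(5 / 32 * s)))) := by
        gcongr
        exact_mod_cast hcard
    _ = _ := by ring

lemma sum_ite_lt_eq {M : Type*} [AddCommMonoid M] {r N : ℕ} (hr : r ≤ N) (f : Fin N → M) :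
    ∑ j : Fin N, (if (j : ℕ) < r then f j else 0) = ∑ i : Fin r, f (Fin.castLE hr i) := by
  symm
  refine Finset.sum_of_injOn (Fin.castLE hr) (Fin.castLE_injective hr).injOn
    (fun _ _ => Finset.mem_coe.2 (Finset.mem_univ _)) (fun j _ hj => ?_) (fun i _ => by simp)
  refine if_neg fun h => hj ⟨⟨j, h⟩, by simp, rfl⟩

lemma headMat_mulVec_eq {r N : ℕ} (hr : r ≤ N) (lam : Fin N → ℝ) (u v : Fin N → Fin N → ℂ)
    (x : Fin N → ℂ) : ∃ a : Fin r → ℂ,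
      (headMat lam u v r).mulVec x = ∑ j, a j • u (Fin.castLE hr j) := by
  refine ⟨fun j => lam (Fin.castLE hr j) *
    ∑ k, (starRingEnd ℂ) (v (Fin.castLE hr j) k) * x k, ?_⟩
  rw [headMat, sum_ite_lt_eq hr, Matrix.sum_mulVec]
  refine Finset.sum_congr rfl fun j _ => ?_
  ext i
  simp only [Matrix.mulVec, dotProduct, Matrix.smul_apply, Matrix.vecMulVec_apply, Pi.smul_apply,
    smul_eq_mul, Complex.real_smul, Finset.mul_sum, Finset.sum_mul]
  exact Finset.sum_congr rfl fun k _ => by ring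

lemma headMat_conjTranspose {N : ℕ} (lam : Fin N → ℝ) (u v : Fin N → Fin N → ℂ) (r : ℕ) :
    (headMat lam u v r)ᴴ = headMat lam v u r := by
  rw [headMat, headMat, Matrix.conjTranspose_sum]
  refine Finset.sum_congr rfl fun j _ => ?_
  split_ifs
  · ext a b
    simp [Matrix.vecMulVec_apply, mul_comm]
  · simp

lemma exp_bounds_of_max {r N e s : ℕ} {p X : ℝ} (hr : 1 ≤ r) (he : 1 ≤ e) (hp0 : 0 < p)
    (hp1 : p < 1)
    (hX : X = max ((r : ℝ) * Real.log (231 / ((e : ℝ)⁻¹ * p))) (Real.log (48 * ((N : ℝ) - r) / p)))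
    (hs : s = ⌊32 * X⌋₊) :
    0 < s ∧ (2 * s : ℝ) ≤ 64 * X ∧
      9 ^ (2 * r) * (8 * Real.exp (-(5 / 32 * s))) ≤ p / 3 ∧
      2 * ((N : ℝ) - r) * (8 * Real.exp (-(5 / 32 * s))) ≤ p / 3 := by
  have he' : (1 : ℝ) ≤ e := by exact_mod_cast he
  have hr' : (1 : ℝ) ≤ r := by exact_mod_cast hr
  have h231 : 231 / p ≤ 231 / ((e : ℝ)⁻¹ * p) := by
    gcongr
    exact mul_le_of_le_one_left hp0.le (inv_le_one_of_one_le₀ he')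
  have hlog1 : 1 ≤ Real.log (231 / p) := by
    rw [Real.le_log_iff_exp_le (by positivity), le_div_iff₀ hp0]
    nlinarith [Real.exp_one_lt_d9, Real.exp_pos 1]
  have hXr : r * Real.log (231 / p) ≤ X := by
    rw [hX]
    refine le_trans ?_ (le_max_left _ _)
    gcongr
  have hX1 : 1 ≤ X := by nlinarith
  have hfl : 32 * X - 1 < s := by rw [hs]; exact Nat.sub_one_lt_floor _
  have hfl2 : (s : ℝ) ≤ 32 * X := by rw [hs]; exact Nat.floor_le (by linarith)
  have hexp : Real.exp (-(5 / 32 * s)) ≤ Real.exp (-(2 * X)) := by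
    apply Real.exp_le_exp.2; linarith
  refine ⟨?_, by linarith, ?_, ?_⟩
  · have : (0 : ℝ) < s := by linarith
    exact_mod_cast this
  · have h1 : Real.exp (-(2 * X)) ≤ (p / 231) ^ (2 * r) := by
      calc Real.exp (-(2 * X)) ≤ Real.exp (((2 * r : ℕ) : ℝ) * -Real.log (231 / p)) := by
            apply Real.exp_le_exp.2; push_cast; linarith
        _ = (p / 231) ^ (2 * r) := by
            rw [Real.exp_nat_mul, ← Real.log_inv, Real.exp_log (by positivity), inv_div]
    calc _ ≤ 9 ^ (2 * r) * (8 * (p / 231) ^ (2 * r)) := by gcongr; exact hexp.trans h1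
      _ = 8 * (9 * p / 231) ^ (2 * r) := by
        rw [show 9 * p / 231 = 9 * (p / 231) by ring, mul_pow]; ring
      _ ≤ 8 * (9 * p / 231) ^ 2 := by
        refine mul_le_mul_of_nonneg_left (pow_le_pow_of_le_one (by positivity) ?_ (by omega))
          (by norm_num)
        rw [div_le_one (by norm_num)]; linarith
      _ ≤ p / 3 := by nlinarith
  · rcases le_or_gt ((N : ℝ) - r) 0 with h | h
    · have : 2 * ((N : ℝ) - r) * (8 * Real.exp (-(5 / 32 * s))) ≤ 0 :=
        mul_nonpos_of_nonpos_of_nonneg (by linarith) (by positivity)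
      linarith
    · have h1 : Real.exp (-(5 / 32 * s)) ≤ p / (48 * ((N : ℝ) - r)) := by
        calc _ ≤ Real.exp (-(2 * X)) := hexp
          _ ≤ Real.exp (-Real.log (48 * ((N : ℝ) - r) / p)) := by
            apply Real.exp_le_exp.2
            have := le_max_right ((r : ℝ) * Real.log (231 / ((e : ℝ)⁻¹ * p)))
              (Real.log (48 * ((N : ℝ) - r) / p))
            rw [← hX] at this
            linarith
          _ = _ := by rw [← Real.log_inv, Real.exp_log (by positivity), inv_div]
      calc _ ≤ 2 * ((N : ℝ) - r) * (8 * (p / (48 * ((N : ℝ) - r)))) := by gcongr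
        _ = p / 3 := by field_simp; norm_num

lemma jl_bounds_of_abs_le {m N : ℕ} {M : Matrix (Fin m) (Fin N) ℝ} {ε : ℝ} {x : Fin N → ℂ}
    (h : |nsq ((M.map (fun a => (a : ℂ))).mulVec x) - nsq x| ≤ ε * nsq x) :
    (1 - ε) * nsq x ≤ nsq ((M.map (fun a => (a : ℂ))).mulVec x) ∧
      nsq ((M.map (fun a => (a : ℂ))).mulVec x) ≤ (1 + ε) * nsq x := by
  rw [abs_le] at h
  constructor <;> linarith [h.1, h.2]

/-- A matrix with the restricted isometry property and random column signs is, with high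
probability, a JL map of the singular subspaces and of the tail singular vectors. -/
lemma one_sub_le_prob_jl {m N r e : ℕ} (lam : Fin N → ℝ) {u v : Fin N → Fin N → ℂ}
    (hu : ∀ i j, ∑ k, (starRingEnd ℂ) (u i k) * u j k = if i = j then 1 else 0)
    (hv : ∀ i j, ∑ k, (starRingEnd ℂ) (v i k) * v j k = if i = j then 1 else 0)
    (hr : 1 ≤ r ∧ r ≤ N) (he : 1 ≤ e) {p : ℝ} (hp0 : 0 < p) (hp1 : p < 1)
    {B : Matrix (Fin m) (Fin N) ℝ}
    (hB : RIPr B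
      (64 * max ((r : ℝ) * Real.log (231 / ((e : ℝ)⁻¹ * p)))
        (Real.log (48 * ((N : ℝ) - r) / p))) ((e : ℝ)⁻¹ / 8)) :
    ((Finset.univ.filter (fun δ : Fin N → Bool =>
        IsJLMapR (B * diagSign δ) ((e : ℝ)⁻¹) (Set.range (headMat lam u v r).mulVec) ∧
        IsJLMapR (B * diagSign δ) ((e : ℝ)⁻¹) (Set.range ((headMat lam u v r)ᴴ).mulVec) ∧
        IsJLMapR (B * diagSign δ) ((e : ℝ)⁻¹)
          {x | ∃ j : Fin N, r ≤ (j : ℕ) ∧ (x = u j ∨ x = v j)})).card : ℝ) /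
      (Fintype.card (Fin N → Bool)) ≥ 1 - p := by
  set X := max ((r : ℝ) * Real.log (231 / ((e : ℝ)⁻¹ * p)))
    (Real.log (48 * ((N : ℝ) - r) / p)) with hX
  obtain ⟨hs, hS, hb1, hb2⟩ := exp_bounds_of_max hr.1 he hp0 hp1 hX rfl
  set s := ⌊32 * X⌋₊
  have he' : (0 : ℝ) < e := by exact_mod_cast he
  have hδ : 0 < (e : ℝ)⁻¹ / 8 := by positivity
  set q : (Fin N → Bool) → (Fin N → ℂ) → ℝ := fun ξ x =>
    |nsq (((B * diagSign ξ).map (fun a => (a : ℂ))).mulVec x) - nsq x| with hq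
  set w : (Fin N → Fin N → ℂ) → (Fin r → ℂ) → Fin N → ℂ := fun u a =>
    ∑ j, a j • u (Fin.castLE hr.2 j) with hw
  set good := Finset.univ.filter (fun δ : Fin N → Bool =>
        IsJLMapR (B * diagSign δ) ((e : ℝ)⁻¹) (Set.range (headMat lam u v r).mulVec) ∧
        IsJLMapR (B * diagSign δ) ((e : ℝ)⁻¹) (Set.range ((headMat lam u v r)ᴴ).mulVec) ∧
        IsJLMapR (B * diagSign δ) ((e : ℝ)⁻¹)
          {x | ∃ j : Fin N, r ≤ (j : ℕ) ∧ (x = u j ∨ x = v j)}) with hgood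
  set bs : (Fin N → Fin N → ℂ) → Finset (Fin N → Bool) := fun u =>
    Finset.univ.filter fun ξ => ¬ ∀ a : Fin r → ℂ,
      q ξ (w u a) ≤ 8 * ((e : ℝ)⁻¹ / 8) * nsq (w u a) with hbs
  set bv : (Fin N → ℂ) → Finset (Fin N → Bool) := fun x =>
    Finset.univ.filter fun ξ => ¬ q ξ x ≤ 4 * ((e : ℝ)⁻¹ / 8) * nsq x with hbv
  set tail := Finset.univ.filter fun j : Fin N => r ≤ (j : ℕ) with htail
  have hspan : ∀ u : Fin N → Fin N → ℂ,
      (∀ i j, ∑ k, (starRingEnd ℂ) (u i k) * u j k = if i = j then 1 else 0) →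
      ((bs u).card : ℝ) ≤ 2 ^ N * (p / 3) := fun u hu =>
    (card_large_distortion_span_le hs hδ hB hS (w := fun j => u (Fin.castLE hr.2 j))
      fun i j => by simp [hu, Fin.castLE_inj]).trans (mul_le_mul_of_nonneg_left hb1 (by positivity))
  have hvec : ∀ x, ((bv x).card : ℝ) ≤ 2 ^ N * (8 * Real.exp (-(5 / 32 * s))) := fun x =>
    card_large_distortion_le hs hδ hB hS x
  have htcard : (tail.card : ℝ) ≤ (N : ℝ) - r := by
    have : tail.card ≤ (Finset.Ico r N).card :=
      Finset.card_le_card_of_injOn Fin.val (fun j hj => by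
        simp only [htail, Finset.coe_filter, Finset.mem_univ, true_and] at hj
        exact Finset.mem_coe.2 (Finset.mem_Ico.2 ⟨hj, j.isLt⟩)) Fin.val_injective.injOn
    rw [Nat.card_Ico] at this
    rw [← Nat.cast_sub hr.2]
    exact_mod_cast this
  have hcover : (Finset.univ : Finset (Fin N → Bool)) ⊆
      good ∪ (bs u ∪ bs v ∪ tail.biUnion fun j => bv (u j) ∪ bv (v j)) := by
    intro ξ _
    by_contra hcon
    simp only [Finset.mem_union, not_or, Finset.mem_biUnion, not_exists, not_and] at hcon
    obtain ⟨hg, ⟨h1, h2⟩, h3⟩ := hcon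
    simp only [hbs, Finset.mem_filter, Finset.mem_univ, true_and, not_not] at h1 h2
    refine hg (Finset.mem_filter.2 ⟨Finset.mem_univ _, ?_, ?_, ?_⟩)
    · rintro _ ⟨x, rfl⟩
      obtain ⟨a, ha⟩ := headMat_mulVec_eq hr.2 lam u v x
      rw [ha]
      exact jl_bounds_of_abs_le ((h1 a).trans_eq (by ring))
    · rintro _ ⟨x, rfl⟩
      rw [headMat_conjTranspose]
      obtain ⟨a, ha⟩ := headMat_mulVec_eq hr.2 lam v u x
      rw [ha]
      exact jl_bounds_of_abs_le ((h2 a).trans_eq (by ring))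
    · have h4 : ∀ x, ξ ∉ bv x → q ξ x ≤ (e : ℝ)⁻¹ * nsq x := by
        intro x hx
        simp only [hbv, Finset.mem_filter, Finset.mem_univ, true_and, not_not] at hx
        have : 0 ≤ (e : ℝ)⁻¹ * nsq x := mul_nonneg (by positivity) (nsq_nonneg x)
        linarith
      rintro x ⟨j, hj, hx⟩
      have h5 := h3 j (by simp [htail, hj])
      rcases hx with rfl | rfl
      exacts [jl_bounds_of_abs_le (h4 _ h5.1), jl_bounds_of_abs_le (h4 _ h5.2)]
  have hcardle : (2 : ℝ) ^ N ≤ good.card + 2 ^ N * p := by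
    have h1 : (2 : ℝ) ^ N = ((Finset.univ : Finset (Fin N → Bool)).card : ℝ) := by simp
    have h2 : ((Finset.univ : Finset (Fin N → Bool)).card : ℝ) ≤ good.card + ((bs u).card +
        (bs v).card + ∑ j ∈ tail, (((bv (u j)).card : ℝ) + (bv (v j)).card)) := by
      have : (Finset.univ : Finset (Fin N → Bool)).card ≤ good.card + ((bs u).card +
        (bs v).card + ∑ j ∈ tail, ((bv (u j)).card + (bv (v j)).card)) :=
        (Finset.card_le_card hcover).trans <| (Finset.card_union_le _ _).trans <|
          Nat.add_le_add_left ((Finset.card_union_le _ _).trans <|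
            Nat.add_le_add (Finset.card_union_le _ _) <| Finset.card_biUnion_le.trans <|
              Finset.sum_le_sum fun j _ => Finset.card_union_le _ _) _
      exact_mod_cast this
    have h3 : ∑ j ∈ tail, (((bv (u j)).card : ℝ) + (bv (v j)).card) ≤ 2 ^ N * (p / 3) := by
      calc _ ≤ ∑ _j ∈ tail, 2 * (2 ^ N * (8 * Real.exp (-(5 / 32 * (s : ℝ))))) :=
            Finset.sum_le_sum fun j _ => by linarith [hvec (u j), hvec (v j)]
        _ = tail.card * (2 * (2 ^ N * (8 * Real.exp (-(5 / 32 * (s : ℝ)))))) := by simp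
        _ ≤ ((N : ℝ) - r) * (2 * (2 ^ N * (8 * Real.exp (-(5 / 32 * (s : ℝ)))))) := by gcongr
        _ = 2 ^ N * (2 * ((N : ℝ) - r) * (8 * Real.exp (-(5 / 32 * (s : ℝ))))) := by ring
        _ ≤ _ := mul_le_mul_of_nonneg_left hb2 (by positivity)
    have h4 := hspan u hu
    have h5 := hspan v hv
    linarith
  have hF : (Fintype.card (Fin N → Bool) : ℝ) = 2 ^ N := by simp
  rw [ge_iff_le, hF, le_div_iff₀ (by positivity)]
  linarith

/-- A center that is close to every point having more than half of the samples nearby. -/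
lemma exists_robust_center {ι : Type*} (R : Finset ι) (y : ι → ℂ) :
    ∃ w : ℂ, ∀ z : ℂ, ∀ η : ℝ, R.card < 2 * (R.filter fun j => ‖y j - z‖ ≤ η).card →
      ‖w - z‖ ≤ 3 * η := by
  set P := (R ×ˢ R).filter fun q =>
    R.card < 2 * (R.filter fun j => ‖y j - y q.1‖ ≤ ‖y q.2 - y q.1‖).card with hP
  have hpair : ∀ z : ℂ, ∀ η : ℝ, R.card < 2 * (R.filter fun j => ‖y j - z‖ ≤ η).card →
      ∃ q ∈ P, ‖y q.2 - y q.1‖ ≤ 2 * η := by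
    intro z η h
    obtain ⟨a, ha⟩ := Finset.card_pos.1 (show 0 < (R.filter fun j => ‖y j - z‖ ≤ η).card by omega)
    obtain ⟨b, hb, hmax⟩ := Finset.exists_max_image _ (fun j => ‖y j - y a‖) ⟨a, ha⟩
    have ha' := Finset.mem_filter.1 ha
    have hb' := Finset.mem_filter.1 hb
    refine ⟨(a, b), Finset.mem_filter.2 ⟨Finset.mem_product.2 ⟨ha'.1, hb'.1⟩, ?_⟩, ?_⟩
    · refine h.trans_le (Nat.mul_le_mul_left 2 (Finset.card_le_card fun j hj => ?_))
      exact Finset.mem_filter.2 ⟨(Finset.mem_filter.1 hj).1, hmax j hj⟩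
    · calc ‖y b - y a‖ ≤ ‖y b - z‖ + ‖z - y a‖ := norm_sub_le_norm_sub_add_norm_sub _ _ _
        _ ≤ η + η := add_le_add hb'.2 (by rw [norm_sub_rev]; exact ha'.2)
        _ = 2 * η := by ring
  rcases P.eq_empty_or_nonempty with hempty | hne
  · refine ⟨0, fun z η h => ?_⟩
    obtain ⟨q, hq, -⟩ := hpair z η h
    simp [hempty] at hq
  · obtain ⟨q, hq, hmin⟩ := Finset.exists_min_image P (fun q => ‖y q.2 - y q.1‖) hne
    refine ⟨y q.1, fun z η h => ?_⟩
    obtain ⟨q', hq', hle⟩ := hpair z η h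
    have hρ : ‖y q.2 - y q.1‖ ≤ 2 * η := (hmin q' hq').trans hle
    have hq2 := (Finset.mem_filter.1 hq).2
    obtain ⟨j, hj⟩ : ((R.filter fun j => ‖y j - y q.1‖ ≤ ‖y q.2 - y q.1‖) ∩
        R.filter fun j => ‖y j - z‖ ≤ η).Nonempty := by
      rw [Finset.nonempty_iff_ne_empty]
      intro hdis
      have h1 := Finset.card_union_of_disjoint (Finset.disjoint_iff_inter_eq_empty.2 hdis)
      have h2 := Finset.card_le_card (Finset.union_subset
        (Finset.filter_subset (fun j => ‖y j - y q.1‖ ≤ ‖y q.2 - y q.1‖) R)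
        (Finset.filter_subset (fun j => ‖y j - z‖ ≤ η) R))
      omega
    rw [Finset.mem_inter, Finset.mem_filter, Finset.mem_filter] at hj
    calc ‖y q.1 - z‖ ≤ ‖y q.1 - y j‖ + ‖y j - z‖ := norm_sub_le_norm_sub_add_norm_sub _ _ _
      _ ≤ 2 * η + η := add_le_add (by rw [norm_sub_rev]; exact hj.1.2.trans hρ) hj.2.2
      _ = 3 * η := by ring

/-- In a coherent binary matrix, more than half of the rows seeing a given coordinate are nearly
free of interference from the other coordinates. -/
lemma card_lt_two_mul_card_good_rows {m N K α s : ℕ} {W : Matrix (Fin m) (Fin N) ℝ}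
    (hW : Coherent W K (α : ℝ)) (hcol : ∀ j, ∑ i, W i j = (K : ℝ)) (hK : 0 < K) (hs : 0 < s)
    (hα : 4 * s * α ≤ K) (z : Fin N → ℂ) (g y : Fin m → ℂ) {ν : ℝ} (hg : ∀ j, ‖g j‖ ≤ ν)
    (hy : ∀ j, y j = ∑ l, (W j l : ℂ) * z l + g j) (S : Finset (Fin N)) (hS : S.card ≤ s)
    (n : Fin N) :
    (Finset.univ.filter fun j => W j n = 1).card <
      2 * ((Finset.univ.filter fun j => W j n = 1).filter fun j =>
        ‖y j - z n‖ ≤ (∑ l ∈ Sᶜ, ‖z l‖) / s + ν).card := by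
  obtain ⟨hbin, -, hinner⟩ := hW
  have hs' : (0 : ℝ) < s := by exact_mod_cast hs
  have hW0 : ∀ j l, 0 ≤ W j l := fun j l => by rcases hbin j l with h | h <;> simp [h]
  set R := Finset.univ.filter fun j => W j n = 1 with hR
  set τ := ∑ l ∈ Sᶜ, ‖z l‖ with hτ
  have hRsum : ∀ F : Fin m → ℝ, ∑ j ∈ R, F j = ∑ j, W j n * F j := fun F => by
    rw [hR, Finset.sum_filter]
    refine Finset.sum_congr rfl fun j _ => ?_
    rcases hbin j n with h | h <;> simp [h]
  have hRcard : R.card = K := by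
    have : (R.card : ℝ) = K := by
      rw [← hcol n]
      simpa using hRsum fun _ => 1
    exact_mod_cast this
  have hpair : ∀ l, n ≠ l → ∑ j ∈ R, W j l ≤ α := fun l hl => by
    rw [hRsum]; exact hinner n l hl
  set B1 := (S.erase n).biUnion fun l => R.filter fun j => W j l = 1 with hB1
  set B2 := R.filter fun j => τ / s < ∑ l ∈ Sᶜ.erase n, W j l * ‖z l‖ with hB2
  have hB1card : B1.card ≤ s * α := by
    calc B1.card ≤ (S.erase n).card * α := Finset.card_biUnion_le_card_mul _ _ _ fun l hl => by
          have h : ((R.filter fun j => W j l = 1).card : ℝ) ≤ α := by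
            refine le_trans (le_of_eq ?_) (hpair l (Finset.ne_of_mem_erase hl).symm)
            rw [Finset.card_filter]
            push_cast
            refine Finset.sum_congr rfl fun j _ => ?_
            rcases hbin j l with h | h <;> simp [h]
          exact_mod_cast h
      _ ≤ s * α := Nat.mul_le_mul_right _ ((Finset.card_erase_le).trans hS)
  have hB2sum : ∑ j ∈ R, ∑ l ∈ Sᶜ.erase n, W j l * ‖z l‖ ≤ α * τ := by
    rw [Finset.sum_comm]
    calc _ ≤ ∑ l ∈ Sᶜ.erase n, α * ‖z l‖ := Finset.sum_le_sum fun l hl => by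
          rw [← Finset.sum_mul]
          exact mul_le_mul_of_nonneg_right (hpair l (Finset.ne_of_mem_erase hl).symm)
            (norm_nonneg _)
      _ ≤ ∑ l ∈ Sᶜ, α * ‖z l‖ := Finset.sum_le_sum_of_subset_of_nonneg (Finset.erase_subset _ _)
          fun l _ _ => by positivity
      _ = α * τ := by rw [← Finset.mul_sum]
  have hτ0 : 0 ≤ τ := Finset.sum_nonneg fun _ _ => norm_nonneg _
  have hB2card : B2.card = 0 ∨ B2.card < s * α := by
    rcases B2.eq_empty_or_nonempty with h | hne
    · left; simp [h]
    · right
      have h1 : (B2.card : ℝ) * (τ / s) < α * τ := by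
        calc (B2.card : ℝ) * (τ / s) = ∑ _j ∈ B2, τ / s := by simp
          _ < ∑ j ∈ B2, ∑ l ∈ Sᶜ.erase n, W j l * ‖z l‖ :=
            Finset.sum_lt_sum_of_nonempty hne fun j hj => (Finset.mem_filter.1 hj).2
          _ ≤ ∑ j ∈ R, ∑ l ∈ Sᶜ.erase n, W j l * ‖z l‖ :=
            Finset.sum_le_sum_of_subset_of_nonneg (Finset.filter_subset _ _) fun j _ _ =>
              Finset.sum_nonneg fun l _ => mul_nonneg (hW0 j l) (norm_nonneg _)
          _ ≤ _ := hB2sum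
      rw [mul_div_assoc', div_lt_iff₀ hs'] at h1
      have h2 : (B2.card : ℝ) * τ < (s * α) * τ := by linarith
      have h3 := lt_of_mul_lt_mul_right h2 hτ0
      exact_mod_cast h3
  have hsub : R ⊆ (R.filter fun j => ‖y j - z n‖ ≤ τ / s + ν) ∪ (B1 ∪ B2) := by
    intro j hj
    by_contra hcon
    simp only [Finset.mem_union, not_or] at hcon
    obtain ⟨hgood, hn1, hn2⟩ := hcon
    refine hgood (Finset.mem_filter.2 ⟨hj, ?_⟩)
    have hjn : W j n = 1 := (Finset.mem_filter.1 hj).2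
    have hz : ∀ l ∈ S.erase n, W j l = 0 := fun l hl => by
      rcases hbin j l with h | h
      · exact h
      · exact absurd (Finset.mem_biUnion.2 ⟨l, hl, Finset.mem_filter.2 ⟨hj, h⟩⟩) hn1
    have h2 : ∑ l ∈ Sᶜ.erase n, W j l * ‖z l‖ ≤ τ / s := by
      by_contra h
      exact hn2 (Finset.mem_filter.2 ⟨hj, not_le.1 h⟩)
    have e1 : y j - z n = ∑ l ∈ Finset.univ.erase n, (W j l : ℂ) * z l + g j := by
      rw [hy, ← Finset.sum_erase_add _ _ (Finset.mem_univ n), hjn]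
      push_cast; ring
    have e2 : ∑ l ∈ Sᶜ.erase n, (W j l : ℂ) * z l =
        ∑ l ∈ Finset.univ.erase n, (W j l : ℂ) * z l := by
      refine Finset.sum_subset (Finset.erase_subset_erase _ (Finset.subset_univ _))
        fun l hl hl' => ?_
      rw [Finset.mem_erase] at hl
      have hlS : l ∈ S := by
        by_contra h
        exact hl' (Finset.mem_erase.2 ⟨hl.1, Finset.mem_compl.2 h⟩)
      rw [hz l (Finset.mem_erase.2 ⟨hl.1, hlS⟩)]; simp
    rw [e1, ← e2]
    refine (norm_add_le _ _).trans (add_le_add (le_trans ?_ h2) (hg j))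
    refine (norm_sum_le _ _).trans (Finset.sum_le_sum fun l _ => ?_)
    rw [norm_mul, Complex.norm_real, Real.norm_of_nonneg (hW0 j l)]
  have h1 := Finset.card_le_card hsub
  have h2 := Finset.card_union_le (R.filter fun j => ‖y j - z n‖ ≤ τ / s + ν) (B1 ∪ B2)
  have h3 := Finset.card_union_le B1 B2
  have h4 : 4 * (s * α) ≤ K := by rwa [← mul_assoc]
  rw [hRcard] at h1 ⊢
  rcases hB2card with h | h <;> omega

/-- A set of coordinates of largest magnitude. -/
lemma exists_top_coordinates {N : ℕ} (a : Fin N → ℝ) (k : ℕ) :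
    ∃ T : Finset (Fin N), T.card ≤ k ∧ (∀ i ∈ T, ∀ j ∉ T, a j ≤ a i) ∧
      ∀ S : Finset (Fin N), S.card ≤ k → (S \ T).card ≤ (T \ S).card := by
  suffices h : ∃ T : Finset (Fin N), T.card ≤ k ∧ (∀ i ∈ T, ∀ j ∉ T, a j ≤ a i) ∧
      (T = Finset.univ ∨ T.card = k) by
    obtain ⟨T, h1, h2, h3⟩ := h
    refine ⟨T, h1, h2, fun S hS => ?_⟩
    rcases h3 with rfl | h3
    · rw [Finset.sdiff_eq_empty_iff_subset.2 (Finset.subset_univ S), Finset.card_empty]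
      exact Nat.zero_le _
    · have e1 := Finset.card_sdiff_add_card_inter S T
      have e2 := Finset.card_sdiff_add_card_inter T S
      rw [Finset.inter_comm] at e2
      omega
  induction k with
  | zero => exact ⟨∅, by simp, by simp, Or.inr rfl⟩
  | succ k ih =>
    obtain ⟨T, h1, h2, h3⟩ := ih
    rcases h3 with h3 | h3
    · exact ⟨T, by omega, h2, Or.inl h3⟩
    · by_cases hT : T = Finset.univ
      · exact ⟨T, by omega, h2, Or.inl hT⟩
      obtain ⟨b, hb, hmax⟩ := Finset.exists_max_image Tᶜ a (by
        rw [Finset.nonempty_iff_ne_empty]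
        intro h
        exact hT (by rwa [Finset.compl_eq_empty_iff] at h))
      rw [Finset.mem_compl] at hb
      have hc := Finset.card_insert_of_notMem hb
      refine ⟨insert b T, by omega, fun i hi j hj => ?_, Or.inr (by omega)⟩
      rw [Finset.mem_insert, not_or] at hj
      rcases Finset.mem_insert.1 hi with rfl | hi
      · exact hmax j (Finset.mem_compl.2 hj.2)
      · exact h2 i hi j hj.2

lemma sqrt_sum_add_sq_le {ι : Type*} [Fintype ι] (a b : ι → ℝ) :
    √(∑ i, (a i + b i) ^ 2) ≤ √(∑ i, a i ^ 2) + √(∑ i, b i ^ 2) := by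
  have h := norm_add_le (WithLp.toLp 2 a) (WithLp.toLp 2 b)
  rw [EuclideanSpace.norm_eq, EuclideanSpace.norm_eq, EuclideanSpace.norm_eq] at h
  simpa using h

/-- The error of keeping the coordinates where an entrywise accurate estimate is largest. -/
lemma l2_sub_threshold_le {N k : ℕ} {z y : Fin N → ℂ} {η : ℝ} (hη : 0 ≤ η)
    (hy : ∀ i, ‖y i - z i‖ ≤ η) {T : Finset (Fin N)} (hTk : T.card ≤ k)
    (htop : ∀ i ∈ T, ∀ j ∉ T, ‖y j‖ ≤ ‖y i‖) {S : Finset (Fin N)} (hS : S.card ≤ k)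
    (hcard : (S \ T).card ≤ (T \ S).card) :
    l2 (z - fun i => if i ∈ T then y i else 0) ≤ √(∑ i ∈ Sᶜ, ‖z i‖ ^ 2) + √(5 * k) * η := by
  obtain ⟨φ, hφ, hinj⟩ : ∃ φ : Fin N → Fin N, (∀ i ∈ S \ T, φ i ∈ T \ S) ∧
      Set.InjOn φ (S \ T : Finset (Fin N)) := by
    obtain ⟨f⟩ : Nonempty ((S \ T : Finset (Fin N)) ↪ (T \ S : Finset (Fin N))) :=
      Function.Embedding.nonempty_of_card_le (by simpa only [Fintype.card_coe] using hcard)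
    refine ⟨fun i => if h : i ∈ S \ T then f ⟨i, h⟩ else i, fun i hi => ?_,
      fun i hi j hj hij => ?_⟩
    · simp only [hi, dif_pos]
      exact (f ⟨i, hi⟩).2
    · rw [Finset.mem_coe] at hi hj
      simp only [hi, hj, dif_pos] at hij
      exact congrArg Subtype.val (f.injective (Subtype.ext hij))
  set a : Fin N → ℝ := fun i =>
    if i ∈ T then 0 else if i ∈ S then ‖z (φ i)‖ else ‖z i‖ with ha
  set b : Fin N → ℝ := fun i => if i ∈ T then η else if i ∈ S then 2 * η else 0 with hb
  have hpt : ∀ i, ‖(z - fun i => if i ∈ T then y i else 0) i‖ ≤ a i + b i := by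
    intro i
    by_cases hT : i ∈ T
    · simp only [ha, hb, Pi.sub_apply, hT, if_true, zero_add]
      rw [norm_sub_rev]; exact hy i
    by_cases hiS : i ∈ S
    · simp only [ha, hb, Pi.sub_apply, hT, hiS, if_true, if_false, sub_zero]
      have h1 := htop _ (Finset.mem_sdiff.1 (hφ i (Finset.mem_sdiff.2 ⟨hiS, hT⟩))).1 i hT
      have h2 := norm_le_norm_add_norm_sub' (z i) (y i)
      have h3 := norm_le_norm_add_norm_sub' (y (φ i)) (z (φ i))
      have h4 := hy i
      have h5 := hy (φ i)
      rw [norm_sub_rev] at h4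
      linarith
    · simp [ha, hb, hT, hiS]
  have hasum : ∑ i, a i ^ 2 ≤ ∑ i ∈ Sᶜ, ‖z i‖ ^ 2 := by
    have h1 : ∑ i, a i ^ 2 = ∑ i ∈ S \ T, ‖z (φ i)‖ ^ 2 + ∑ i ∈ Sᶜ \ T, ‖z i‖ ^ 2 := by
      rw [← Finset.sum_add_sum_compl S]
      congr 1
      · rw [Finset.sdiff_eq_filter, Finset.sum_filter]
        refine Finset.sum_congr rfl fun i hi => ?_
        by_cases hT : i ∈ T <;> simp [ha, hT, hi]
      · rw [Finset.sdiff_eq_filter, Finset.sum_filter]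
        refine Finset.sum_congr rfl fun i hi => ?_
        rw [Finset.mem_compl] at hi
        by_cases hT : i ∈ T <;> simp [ha, hT, hi]
    have h2 : ∑ i ∈ S \ T, ‖z (φ i)‖ ^ 2 ≤ ∑ i ∈ T \ S, ‖z i‖ ^ 2 := by
      rw [← Finset.sum_image (g := φ) (f := fun i => ‖z i‖ ^ 2) hinj]
      refine Finset.sum_le_sum_of_subset_of_nonneg (fun i hi => ?_) fun _ _ _ => sq_nonneg _
      obtain ⟨j, hj, rfl⟩ := Finset.mem_image.1 hi
      exact hφ j hj
    have h3 : ∑ i ∈ T \ S, ‖z i‖ ^ 2 + ∑ i ∈ Sᶜ \ T, ‖z i‖ ^ 2 = ∑ i ∈ Sᶜ, ‖z i‖ ^ 2 := by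
      rw [← Finset.sum_union]
      · refine Finset.sum_congr ?_ fun _ _ => rfl
        ext i
        simp only [Finset.mem_union, Finset.mem_sdiff, Finset.mem_compl]
        tauto
      · rw [Finset.disjoint_left]
        intro i hi hi'
        exact (Finset.mem_sdiff.1 hi').2 (Finset.mem_sdiff.1 hi).1
    linarith
  have hbsum : ∑ i, b i ^ 2 ≤ 5 * k * η ^ 2 := by
    calc ∑ i, b i ^ 2 ≤ ∑ i, ((if i ∈ T then η ^ 2 else 0) + if i ∈ S then 4 * η ^ 2 else 0) := by
          refine Finset.sum_le_sum fun i _ => ?_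
          by_cases hT : i ∈ T <;> by_cases hiS : i ∈ S <;> simp [hb, hT, hiS] <;> nlinarith
      _ = T.card * η ^ 2 + S.card * (4 * η ^ 2) := by
          rw [Finset.sum_add_distrib, ← Finset.sum_filter, ← Finset.sum_filter]
          simp
      _ ≤ k * η ^ 2 + k * (4 * η ^ 2) := by gcongr
      _ = _ := by ring
  calc l2 (z - fun i => if i ∈ T then y i else 0) ≤ √(∑ i, (a i + b i) ^ 2) :=
        Real.sqrt_le_sqrt (Finset.sum_le_sum fun i _ =>
          pow_le_pow_left₀ (norm_nonneg _) (hpt i) 2)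
    _ ≤ √(∑ i, a i ^ 2) + √(∑ i, b i ^ 2) := sqrt_sum_add_sq_le a b
    _ ≤ √(∑ i ∈ Sᶜ, ‖z i‖ ^ 2) + √(5 * k * η ^ 2) :=
        add_le_add (Real.sqrt_le_sqrt hasum) (Real.sqrt_le_sqrt hbsum)
    _ = _ := by rw [Real.sqrt_mul (by positivity), Real.sqrt_sq hη]

/-- Recovery of a vector from noisy measurements by a coherent binary matrix. -/
lemma exists_recovery {m N K α s : ℕ} {W : Matrix (Fin m) (Fin N) ℝ}
    (hW : Coherent W K (α : ℝ)) (hcol : ∀ j, ∑ i, W i j = (K : ℝ)) (hK : 0 < K) (hs : 0 < s)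
    (hα : 4 * s * α ≤ K) (y : Fin m → ℂ) :
    ∃ w : Fin N → ℂ, Set.ncard {i | w i ≠ 0} ≤ 2 * s ∧
      ∀ (z : Fin N → ℂ) (g : Fin m → ℂ) (ν : ℝ), 0 ≤ ν → (∀ j, ‖g j‖ ≤ ν) →
        (∀ j, y j = ∑ l, (W j l : ℂ) * z l + g j) →
        ∀ S₁ S₂ : Finset (Fin N), S₁.card ≤ s → S₂.card ≤ 2 * s →
          l2 (z - w) ≤ √(∑ i ∈ S₂ᶜ, ‖z i‖ ^ 2) +
            6 * (1 + √2) * ((∑ i ∈ S₁ᶜ, ‖z i‖) / √s + √s * ν) := by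
  choose c hc using fun n => exists_robust_center (Finset.univ.filter fun j => W j n = 1) y
  obtain ⟨T, hTk, htop, hcard⟩ := exists_top_coordinates (fun i => ‖c i‖) (2 * s)
  refine ⟨fun i => if i ∈ T then c i else 0, ?_, fun z g ν hν hg hy S₁ S₂ hS₁ hS₂ => ?_⟩
  · refine le_trans (Set.ncard_le_ncard (t := (T : Set (Fin N))) ?_ T.finite_toSet) ?_
    · intro i hi
      by_contra h
      exact hi (if_neg h)
    · rwa [Set.ncard_coe_finset]
  have hs' : (0 : ℝ) < s := by exact_mod_cast hs
  have hτ : 0 ≤ ∑ i ∈ S₁ᶜ, ‖z i‖ := Finset.sum_nonneg fun _ _ => norm_nonneg _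
  set η := (∑ l ∈ S₁ᶜ, ‖z l‖) / s + ν with hη
  have hη0 : 0 ≤ η := by positivity
  have hest : ∀ n, ‖c n - z n‖ ≤ 3 * η := fun n =>
    hc n _ _ (card_lt_two_mul_card_good_rows hW hcol hK hs hα z g y hg hy S₁ hS₁ n)
  refine (l2_sub_threshold_le (by positivity) hest hTk htop hS₂ (hcard S₂ hS₂)).trans ?_
  have h10 : √(5 * (2 * s : ℕ)) * (3 * η) ≤ 6 * (1 + √2) * (√s * η) := by
    push_cast
    rw [show (5 : ℝ) * (2 * s) = 10 * s by ring, Real.sqrt_mul (by norm_num)]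
    have h4 : √10 ≤ 4 := by
      rw [Real.sqrt_le_left (by norm_num)]; norm_num
    have h1 : 1 ≤ √2 := Real.one_le_sqrt.2 (by norm_num)
    have h0 : 0 ≤ √s * η := by positivity
    nlinarith
  have e : √s * η = (∑ i ∈ S₁ᶜ, ‖z i‖) / √s + √s * ν := by
    rw [hη, mul_add]
    congr 1
    have : (s : ℝ) = √s * √s := (Real.mul_self_sqrt hs'.le).symm
    have hsp : 0 < √(s : ℝ) := Real.sqrt_pos.2 hs'
    rw [mul_div_assoc', div_eq_div_iff hs'.ne' hsp.ne']
    nlinarith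
  rw [← e]
  gcongr

lemma khatriRao_bitTestExt_apply_of_lt {m N : ℕ} (W : Matrix (Fin m) (Fin N) ℝ) (j : Fin m)
    (i : Fin (m * (2 * (1 + Nat.clog 2 N)))) (hij : (i : ℕ) = j) (l : Fin N) :
    khatriRao W (bitTestExt N) i l = W j l := by
  have h1 : (i : ℕ) % m = j := by rw [hij]; exact Nat.mod_eq_of_lt j.isLt
  have h2 : (i : ℕ) / m = 0 := by rw [hij]; exact Nat.div_eq_of_lt j.isLt
  simp [khatriRao, h1, h2, bitTestExt, bitTest]

lemma map_diagSign_mulVec {N : ℕ} (δ : Fin N → Bool) (x : Fin N → ℂ) :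
    ((diagSign δ).map (fun a => (a : ℂ))).mulVec x = fun i => (boolSign (δ i) : ℂ) * x i := by
  have : (diagSign δ).map (fun a => (a : ℂ)) =
      Matrix.diagonal fun i => (boolSign (δ i) : ℂ) := by
    rw [diagSign, Matrix.diagonal_map Complex.ofReal_zero]
    rfl
  rw [this]
  ext i
  rw [Matrix.mulVec_diagonal]

lemma norm_boolSign (b : Bool) : ‖(boolSign b : ℂ)‖ = 1 := by
  cases b <;> simp [boolSign]

lemma l2_sub_signed {N : ℕ} (δ : Fin N → Bool) (x w : Fin N → ℂ) :
    l2 (x - fun i => (boolSign (δ i) : ℂ) * w i) =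
      l2 ((fun i => (boolSign (δ i) : ℂ) * x i) - w) := by
  unfold l2 nsq
  congr 1
  refine Finset.sum_congr rfl fun i _ => ?_
  simp only [Pi.sub_apply]
  have : (boolSign (δ i) : ℂ) * x i - w i =
      (boolSign (δ i) : ℂ) * (x i - (boolSign (δ i) : ℂ) * w i) := by
    have h : (boolSign (δ i) : ℂ) * boolSign (δ i) = 1 := by
      exact_mod_cast boolSign_mul_self (δ i)
    rw [mul_sub, ← mul_assoc, h, one_mul]
  rw [this, norm_mul, norm_boolSign, one_mul]

lemma le_bestErr_add {N s k : ℕ} {x : Fin N → ℂ} {C D E : ℝ} (hC : 0 < C)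
    (h : ∀ S₁ S₂ : Finset (Fin N), S₁.card ≤ s → S₂.card ≤ k →
      E ≤ √(∑ i ∈ S₂ᶜ, ‖x i‖ ^ 2) + (C * ∑ i ∈ S₁ᶜ, ‖x i‖) + D) :
    E ≤ bestErr2 x k + C * bestErr1 x s + D := by
  have hsupp : ∀ (v : Fin N → ℂ) (k : ℕ), Set.ncard {i | v i ≠ 0} ≤ k →
      ∃ S : Finset (Fin N), S.card ≤ k ∧ ∀ i ∈ Sᶜ, x i = x i - v i := by
    intro v k hv
    refine ⟨Finset.univ.filter fun i => v i ≠ 0, ?_, fun i hi => ?_⟩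
    · rw [← Set.ncard_coe_finset]
      simpa using hv
    · have : v i = 0 := by simpa using hi
      simp [this]
  have h1 : (E - D - bestErr2 x k) / C ≤ bestErr1 x s := by
    refine le_csInf ⟨_, 0, by simp, rfl⟩ ?_
    rintro _ ⟨v, hv, rfl⟩
    obtain ⟨S₁, hS₁, hx₁⟩ := hsupp v s hv
    rw [div_le_iff₀ hC, sub_le_iff_le_add, ← sub_le_iff_le_add']
    refine le_csInf ⟨_, 0, by simp, rfl⟩ ?_
    rintro _ ⟨v', hv', rfl⟩
    obtain ⟨S₂, hS₂, hx₂⟩ := hsupp v' k hv'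
    have h2 := h S₁ S₂ hS₁ hS₂
    have h3 : ∑ i ∈ S₁ᶜ, ‖x i‖ ≤ ∑ i, ‖x i - v i‖ := by
      calc ∑ i ∈ S₁ᶜ, ‖x i‖ = ∑ i ∈ S₁ᶜ, ‖x i - v i‖ :=
            Finset.sum_congr rfl fun i hi => congrArg _ (hx₁ i hi)
        _ ≤ _ := Finset.sum_le_univ_sum_of_nonneg fun _ => norm_nonneg _
    have h4 : √(∑ i ∈ S₂ᶜ, ‖x i‖ ^ 2) ≤ l2 (x - v') := by
      refine Real.sqrt_le_sqrt ?_
      calc ∑ i ∈ S₂ᶜ, ‖x i‖ ^ 2 = ∑ i ∈ S₂ᶜ, ‖x i - v' i‖ ^ 2 :=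
            Finset.sum_congr rfl fun i hi => congrArg (‖·‖ ^ 2) (hx₂ i hi)
        _ ≤ _ := Finset.sum_le_univ_sum_of_nonneg fun _ => sq_nonneg _
    have h5 := mul_le_mul_of_nonneg_left h3 hC.le
    linarith
  rw [div_le_iff₀ hC] at h1
  linarith

lemma linf_mul_div_l2_mul_l2 {n : ℕ} (x : Fin n → ℂ) (a : ℝ) :
    linf x * a / l2 x * l2 x = linf x * a := by
  by_cases h : l2 x = 0
  · have hx : x = 0 := by
      rw [l2, Real.sqrt_eq_zero (nsq_nonneg x)] at h
      ext i
      have := (Finset.sum_eq_zero_iff_of_nonneg fun i _ => sq_nonneg ‖x i‖).1 h i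
        (Finset.mem_univ i)
      simpa using this
    have : linf x = 0 := by simp [hx, linf]
    simp [this]
  · exact div_mul_cancel₀ _ h

lemma norm_le_linf {n : ℕ} (x : Fin n → ℂ) (i : Fin n) : ‖x i‖ ≤ linf x :=
  le_ciSup (f := fun i => ‖x i‖) (Set.finite_range _).bddAbove i

lemma linf_nonneg {n : ℕ} (x : Fin n → ℂ) : 0 ≤ linf x :=
  Real.iSup_nonneg fun _ => norm_nonneg _

/-- Compressive recovery, for any fixed signs, from the measurements `W̃·D`. -/
lemma exists_signed_recovery {N m K α s : ℕ} {W : Matrix (Fin m) (Fin N) ℝ}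
    (hW : Coherent W K (α : ℝ)) (hcol : ∀ j, ∑ i, W i j = (K : ℝ)) (hK : 0 < K) (hs : 0 < s)
    (hα : 4 * s * α ≤ K) {Wt : Matrix (Fin (m * (2 * (1 + Nat.clog 2 N)))) (Fin N) ℝ}
    (hWt : Wt = (√((K : ℝ) * (1 + Nat.clog 2 N)))⁻¹ • khatriRao W (bitTestExt N))
    (δ : Fin N → Bool) :
    ∃ f : (Fin (m * (2 * (1 + Nat.clog 2 N))) → ℂ) → (Fin N → ℂ),
      (∀ y, Set.ncard {i | f y i ≠ 0} ≤ 2 * s) ∧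
      ∀ (x : Fin N → ℂ) (n : Fin (m * (2 * (1 + Nat.clog 2 N))) → ℂ),
        l2 (x - √((K : ℝ) * (1 + Nat.clog 2 N)) •
            ((diagSign δ).map (fun a => (a : ℂ))).mulVec
              (f ((((Wt * diagSign δ).map (fun a => (a : ℂ))).mulVec x) + n))) ≤
          bestErr2 x (2 * s) +
            6 * (1 + √2) * (bestErr1 x s / √s +
              (linf n * √((s : ℝ) * K * (1 + Nat.clog 2 N)) / l2 n) * l2 n) := by
  have hs' : (0 : ℝ) < s := by exact_mod_cast hs
  have hK' : (0 : ℝ) < K := by exact_mod_cast hK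
  set c := √((K : ℝ) * (1 + Nat.clog 2 N)) with hc
  have hcpos : 0 < c := Real.sqrt_pos.2 (by positivity)
  have hcC : (c : ℂ) ≠ 0 := by exact_mod_cast hcpos.ne'
  set row : Fin m → Fin (m * (2 * (1 + Nat.clog 2 N))) := fun j =>
    ⟨j, j.isLt.trans_le (Nat.le_mul_of_pos_right _ (by omega))⟩ with hrow
  choose g hg1 hg2 using fun y => exists_recovery hW hcol hK hs hα y
  refine ⟨fun y => (c : ℂ)⁻¹ • g fun j => c * y (row j), fun y => ?_, fun x n => ?_⟩
  · have hsub : {i | ((c : ℂ)⁻¹ • g fun j => c * y (row j)) i ≠ 0} ⊆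
        {i | g (fun j => c * y (row j)) i ≠ 0} := by
      intro i hi h
      exact hi (by simp only [Pi.smul_apply, h, smul_zero])
    exact (Set.ncard_le_ncard hsub (Set.toFinite _)).trans (hg1 _)
  set y := ((Wt * diagSign δ).map (fun a => (a : ℂ))).mulVec x + n with hy
  set z : Fin N → ℂ := fun i => (boolSign (δ i) : ℂ) * x i with hz
  have hzx : ∀ i, ‖z i‖ = ‖x i‖ := fun i => by
    rw [hz]; simp only [norm_mul, norm_boolSign, one_mul]
  have hmeas : ∀ j, (c : ℂ) * y (row j) = ∑ l, (W j l : ℂ) * z l + c * n (row j) := by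
    intro j
    have e1 : ((Wt * diagSign δ).map (fun a => (a : ℂ))).mulVec x (row j) =
        ∑ l, (c : ℂ)⁻¹ * ((W j l : ℂ) * z l) := by
      rw [Matrix.mulVec, dotProduct]
      refine Finset.sum_congr rfl fun l _ => ?_
      have : (Wt * diagSign δ) (row j) l = c⁻¹ * W j l * boolSign (δ l) := by
        rw [diagSign, Matrix.mul_diagonal, hWt, Matrix.smul_apply,
          khatriRao_bitTestExt_apply_of_lt W j (row j) rfl, smul_eq_mul]
        rfl
      rw [Matrix.map_apply, this, hz]
      push_cast; ring
    rw [hy, Pi.add_apply, e1, ← Finset.mul_sum, mul_add, mul_inv_cancel_left₀ hcC]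
  have hout : c • ((diagSign δ).map (fun a => (a : ℂ))).mulVec
      ((c : ℂ)⁻¹ • g fun j => c * y (row j)) =
        fun i => (boolSign (δ i) : ℂ) * g (fun j => c * y (row j)) i := by
    rw [map_diagSign_mulVec]
    ext i
    simp only [Pi.smul_apply, smul_eq_mul, Complex.real_smul]
    field_simp
  rw [hout, l2_sub_signed, linf_mul_div_l2_mul_l2]
  have hsq : √((s : ℝ) * K * (1 + Nat.clog 2 N)) = √s * c := by
    rw [hc, ← Real.sqrt_mul hs'.le, mul_assoc]
  have hsp : 0 < √(s : ℝ) := Real.sqrt_pos.2 hs'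
  have h2 : 0 ≤ √(2 : ℝ) := Real.sqrt_nonneg _
  have key := le_bestErr_add (x := x) (s := s) (k := 2 * s) (C := 6 * (1 + √2) / √s)
    (D := 6 * (1 + √2) * (√s * (c * linf n))) (E := l2 (z - g fun j => c * y (row j)))
    (by positivity) fun S₁ S₂ hS₁ hS₂ => by
      have := hg2 _ z (fun j => c * n (row j)) (c * linf n)
        (mul_nonneg hcpos.le (linf_nonneg n)) (fun j => by
          rw [norm_mul, Complex.norm_real, Real.norm_of_nonneg hcpos.le]
          exact mul_le_mul_of_nonneg_left (norm_le_linf n _) hcpos.le) hmeas S₁ S₂ hS₁ hS₂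
      simp only [hzx] at this
      refine this.trans (le_of_eq ?_)
      ring
  refine key.trans (le_of_eq ?_)
  rw [hsq]; ring

/-- The sublinear-time measurement matrix `M = W̃·D` built from a DeVore-type
coherent matrix, the extended bit testing matrix, and a random diagonal sign matrix `D`
simultaneously satisfies the three JL conditions with probability at least `1 − p`, and (for
every realization of `D`) supports sublinear-time sparse recovery. -/
theorem stmt_17 {N : ℕ}
    (A : Matrix (Fin N) (Fin N) ℂ) (lam : Fin N → ℝ) (u v : Fin N → Fin N → ℂ)
    (hord : ∀ i j : Fin N, i ≤ j → lam j ≤ lam i) (hnn : ∀ j, 0 ≤ lam j)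
    (hu : ∀ i j, ∑ k, (starRingEnd ℂ) (u i k) * u j k = if i = j then 1 else 0)
    (hv : ∀ i j, ∑ k, (starRingEnd ℂ) (v i k) * v j k = if i = j then 1 else 0)
    (hA : A = ∑ j, lam j • Matrix.vecMulVec (u j) (fun k => (starRingEnd ℂ) (v j k)))
    (r s e : ℕ) (hr : 1 ≤ r ∧ r ≤ N) (hs : 1 ≤ s ∧ s ≤ N) (he : 1 ≤ e ∧ e ≤ N)
    (p : ℝ) (hp0 : 0 < p) (hp1 : p < 1)
    (t K : ℕ)
    (ht : t = max (4 * s) (512 * r * ⌈Real.log (231 * N / p)⌉₊ * e))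
    (hK : K = t * Nat.clog t N)
    (m' : ℕ) (W : Matrix (Fin m') (Fin N) ℝ)
    (hcoh : Coherent W K ((Nat.log K N : ℕ) : ℝ))
    (hcol : ∀ j, ∑ i, W i j = (K : ℝ))
    -- `W̃ = (K(1+⌈log₂N⌉))^{-1/2}·(W ⊙ B'_N)`
    (Wt : Matrix (Fin (m' * (2 * (1 + Nat.clog 2 N)))) (Fin N) ℝ)
    (hWt : Wt = (Real.sqrt ((K : ℝ) * (1 + Nat.clog 2 N)))⁻¹ • khatriRao W (bitTestExt N))
    (hRIP : RIPr Wt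
      (64 * max ((r : ℝ) * Real.log (231 / ((e : ℝ)⁻¹ * p)))
        (Real.log (48 * ((N : ℝ) - r) / p))) ((e : ℝ)⁻¹ / 8)) :
    -- (i) with probability at least `1 − p` over the Rademacher signs `δ`,
    -- `M = W̃·D` satisfies all three JL conditions
    ((Finset.univ.filter (fun δ : Fin N → Bool =>
        IsJLMapR (Wt * diagSign δ) ((e : ℝ)⁻¹) (Set.range (headMat lam u v r).mulVec) ∧
        IsJLMapR (Wt * diagSign δ) ((e : ℝ)⁻¹) (Set.range ((headMat lam u v r)ᴴ).mulVec) ∧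
        IsJLMapR (Wt * diagSign δ) ((e : ℝ)⁻¹)
          {x | ∃ j : Fin N, r ≤ (j : ℕ) ∧ (x = u j ∨ x = v j)})).card : ℝ) /
      (Fintype.card (Fin N → Bool)) ≥ 1 - p ∧
    -- (ii) for every realization of `D` there is a recovery map `f` with `2s`-sparse outputs
    (∀ δ : Fin N → Bool,
      ∃ f : (Fin (m' * (2 * (1 + Nat.clog 2 N))) → ℂ) → (Fin N → ℂ),
        (∀ y, Set.ncard {i | f y i ≠ 0} ≤ 2 * s) ∧
        ∀ (x : Fin N → ℂ) (n : Fin (m' * (2 * (1 + Nat.clog 2 N))) → ℂ),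
          l2 (x - Real.sqrt ((K : ℝ) * (1 + Nat.clog 2 N)) •
              ((diagSign δ).map (fun a => (a : ℂ))).mulVec
                (f ((((Wt * diagSign δ).map (fun a => (a : ℂ))).mulVec x) + n))) ≤
            bestErr2 x (2 * s) +
              6 * (1 + Real.sqrt 2) * (bestErr1 x s / Real.sqrt s +
                (linf n * Real.sqrt ((s : ℝ) * K * (1 + Nat.clog 2 N)) / l2 n) * l2 n)) := by
  obtain ⟨hs0, hS, -, -⟩ := exp_bounds_of_max hr.1 he.1 hp0 hp1 rfl rfl
  have hN : 0 < N := lt_of_lt_of_le hr.1 hr.2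
  have he' : (1 : ℝ) ≤ e := by exact_mod_cast he.1
  have hKpos : 0 < K := by
    by_contra h
    have hK0 : K = 0 := by omega
    have hW0 : Wt = 0 := by rw [hWt, hK0]; simp
    have h1 := (hRIP (Pi.single ⟨0, hN⟩ 1) ?_).1
    · have e1 : nsq (Pi.single (⟨0, hN⟩ : Fin N) (1 : ℂ)) = 1 := by
        rw [nsq, Finset.sum_eq_single (⟨0, hN⟩ : Fin N)]
        · simp
        · intro i _ hi; simp [Pi.single_eq_of_ne hi]
        · simp
      have e2 : nsq (((Wt.map (fun a => (a : ℂ))).mulVec (Pi.single ⟨0, hN⟩ 1))) = 0 := by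
        rw [hW0, nsq_map_mulVec]; simp
      rw [e1, e2] at h1
      have := inv_le_one_of_one_le₀ he'
      linarith only [h1, this]
    · refine le_trans ?_ hS
      have h2 : Set.ncard {i | (Pi.single (⟨0, hN⟩ : Fin N) (1 : ℂ) : Fin N → ℂ) i ≠ 0} ≤ 1 := by
        rw [Set.ncard_le_one_iff]
        intro a b ha hb
        have h3 : ∀ i, (Pi.single (⟨0, hN⟩ : Fin N) (1 : ℂ) : Fin N → ℂ) i ≠ 0 → i = ⟨0, hN⟩ :=
          fun i hi => by
            by_contra h
            exact hi (Pi.single_eq_of_ne h _)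
        rw [h3 a ha, h3 b hb]
      have h4 := Nat.one_le_iff_ne_zero.2 hs0.ne'
      have h5 := Nat.cast_le (α := ℝ).2 h2
      have h6 := Nat.cast_le (α := ℝ).2 h4
      push_cast at h5 h6
      linarith only [h5, h6]
  have ht4 : 4 * s ≤ t := ht ▸ le_max_left _ _
  have hclog : 1 ≤ Nat.clog t N := by
    by_contra h
    have : Nat.clog t N = 0 := by omega
    rw [hK, this] at hKpos
    omega
  have htK : t ≤ K := hK ▸ Nat.le_mul_of_pos_right t hclog
  have hα : 4 * s * Nat.log K N ≤ K := by
    rw [hK]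
    refine Nat.mul_le_mul ht4 ?_
    rw [← hK]
    exact (Nat.log_anti_left (by omega) htK).trans (Nat.log_le_clog t N)
  exact ⟨one_sub_le_prob_jl lam hu hv hr he.1 hp0 hp1 hRIP,
    exists_signed_recovery hcoh hcol hKpos hs.1 hα hWt⟩
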